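/- arXiv:1905.00034 — 10 statements merged into one kernel-verified Lean document; each statement's English description precedes it below -/
import Mathlib

section
/- Let D ≥ 3. If a bilinear map α : m × m → m is rotation equivariant and lorentzian-boost equivariant, then α = 0. (In other words, the only invariant affine connection on the lorentzian homogeneous kinematical spacetimes of dimension D+1 ≥ 4 — Minkowski, de Sitter and anti de Sitter — is the canonical connection, whose Nomizu map is zero.) -/
open Matrix

/-- The vector space `m = ℝ × ℝ^D`, with elements written `(h, p)`;
`H = (1, 0)` and `P a = (0, e a)`. -/
abbrev Mspace (D : ℕ) : Type := ℝ × (Fin D → ℝ)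

/-- The infinitesimal rotation `ρ_Λ (h, p) = (0, Λ p)` associated to a `D × D` matrix `Λ`. -/
noncomputable def rotMap {D : ℕ} (Λ : Matrix (Fin D) (Fin D) ℝ) :
    Mspace D →ₗ[ℝ] Mspace D :=
  LinearMap.prod 0 (Λ.mulVecLin ∘ₗ LinearMap.snd ℝ ℝ (Fin D → ℝ))

/-- The lorentzian boost `β_a (h, p) = (p_a, h • e_a)`. -/
noncomputable def lorBoost {D : ℕ} (a : Fin D) : Mspace D →ₗ[ℝ] Mspace D :=
  LinearMap.prod
    (LinearMap.proj a ∘ₗ LinearMap.snd ℝ ℝ (Fin D → ℝ))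
    (LinearMap.toSpanSingleton ℝ (Fin D → ℝ) (Pi.single a 1) ∘ₗ
      LinearMap.fst ℝ ℝ (Fin D → ℝ))

/-- A bilinear map `α : m × m → m` is equivariant under a linear endomorphism `X` of `m`
if `X (α Y Z) = α (X Y) Z + α Y (X Z)` for all `Y Z ∈ m`. -/
def IsEquivariant {D : ℕ} (X : Mspace D →ₗ[ℝ] Mspace D)
    (α : Mspace D →ₗ[ℝ] Mspace D →ₗ[ℝ] Mspace D) : Prop :=
  ∀ Y Z : Mspace D, X (α Y Z) = α (X Y) Z + α Y (X Z)

theorem rotMap_apply {D : ℕ} (Λ : Matrix (Fin D) (Fin D) ℝ) (Y : Mspace D) :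
    rotMap Λ Y = (0, Λ *ᵥ Y.2) := rfl

theorem lorBoost_apply {D : ℕ} (a : Fin D) (Y : Mspace D) :
    lorBoost a Y = (Y.2 a, Y.1 • Pi.single a 1) := rfl

/-- The generator of the rotations in the plane spanned by `e b` and `e c`. -/
def planeRotation {D : ℕ} (b c : Fin D) : Matrix (Fin D) (Fin D) ℝ :=
  Matrix.single b c 1 - Matrix.single c b 1

theorem planeRotation_transpose {D : ℕ} (b c : Fin D) :
    (planeRotation b c)ᵀ = -planeRotation b c := by
  simp [planeRotation]

theorem planeRotation_mulVec {D : ℕ} (b c : Fin D) (p : Fin D → ℝ) :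
    planeRotation b c *ᵥ p = Pi.single b (p c) - Pi.single c (p b) := by
  simp [planeRotation, Matrix.sub_mulVec, Matrix.single_mulVec, Pi.single]

theorem rotMap_planeRotation {D : ℕ} (b c : Fin D) (Y : Mspace D) :
    rotMap (planeRotation b c) Y = (0, Pi.single b (Y.2 c) - Pi.single c (Y.2 b)) := by
  rw [rotMap_apply, planeRotation_mulVec]

/-- A vector annihilated by all rotations is a multiple of `H`. -/
theorem snd_eq_zero_of_rotMap_eq_zero {D : ℕ} (hD : 2 ≤ D) (Y : Mspace D)
    (hY : ∀ b c : Fin D, rotMap (planeRotation b c) Y = 0) : Y.2 = 0 := by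
  funext c
  have : Nontrivial (Fin D) := Fin.nontrivial_iff_two_le.2 hD
  obtain ⟨b, hb⟩ := exists_ne c
  have h := congrFun (congrArg Prod.snd (hY b c)) b
  simpa [rotMap_planeRotation, hb] using h

/-- A linear map out of `ℝ^D` into `m` that commutes with rotations sends `e a` to a multiple of
`P a` when `D ≥ 3`. -/
theorem exists_eq_smul_single_of_rotMap {D : ℕ} (hD : 3 ≤ D) (f : Mspace D →ₗ[ℝ] Mspace D)
    (hf : ∀ (b c : Fin D) (Y : Mspace D),
      rotMap (planeRotation b c) (f Y) = f (rotMap (planeRotation b c) Y)) (a : Fin D) :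
    ∃ r : ℝ, f (0, Pi.single a 1) = (0, Pi.single a r) := by
  refine ⟨(f (0, Pi.single a 1)).2 a, ?_⟩
  have : Nontrivial (Fin D) := Fin.nontrivial_iff_two_le.2 (by omega)
  obtain ⟨b, hb⟩ := exists_ne a
  refine Prod.ext ?_ (funext fun c => ?_)
  · have h := congrArg Prod.fst (hf a b (0, Pi.single b 1))
    simpa [rotMap_planeRotation, hb, hb.symm] using h.symm
  · by_cases hc : c = a
    · subst hc
      simp
    · obtain ⟨d, hd⟩ : ∃ d : Fin D, d ∉ ({a, c} : Finset (Fin D)) := by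
        by_contra! h
        have h₁ := Finset.card_le_card (fun x _ => h x : Finset.univ ⊆ ({a, c} : Finset (Fin D)))
        have h₂ := Finset.card_le_two (a := a) (b := c)
        rw [Finset.card_univ, Fintype.card_fin] at h₁
        omega
      simp only [Finset.mem_insert, Finset.mem_singleton, not_or] at hd
      have h := congrFun (congrArg Prod.snd (hf d c (0, Pi.single a 1))) d
      simpa [rotMap_planeRotation, hc, hd.1, hd.2, ← Prod.zero_eq_mk] using h

/-- For `D ≥ 3`, any rotation- and lorentzian-boost-equivariant bilinear map on `m` vanishes:
the only invariant affine connection on the lorentzian homogeneous kinematical spacetimes of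
dimension `D + 1 ≥ 4` is the canonical one, with zero Nomizu map. -/
theorem lorentzian_nomizu_map_eq_zero (D : ℕ) (hD : 3 ≤ D)
    (α : Mspace D →ₗ[ℝ] Mspace D →ₗ[ℝ] Mspace D)
    (hrot : ∀ Λ : Matrix (Fin D) (Fin D) ℝ, Λᵀ = -Λ → IsEquivariant (rotMap Λ) α)
    (hboost : ∀ a : Fin D, IsEquivariant (lorBoost a) α) :
    α = 0 := by
  have hpair : ∀ (b c : Fin D) (Y Z : Mspace D), rotMap (planeRotation b c) (α Y Z) =
      α (rotMap (planeRotation b c) Y) Z + α Y (rotMap (planeRotation b c) Z) :=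
    fun b c => hrot _ (planeRotation_transpose b c)
  have hH : ∀ b c : Fin D, rotMap (planeRotation b c) ((1, 0) : Mspace D) = 0 := fun b c => by
    simp [rotMap_planeRotation]
  set H : Mspace D := (1, 0) with hHdef
  obtain ⟨k, hk⟩ : ∃ k : ℝ, α H H = k • H := by
    refine ⟨(α H H).1, Prod.ext (by simp [hHdef]) ?_⟩
    rw [snd_eq_zero_of_rotMap_eq_zero (by omega) (α H H) fun b c => by simp [hpair, hH]]
    simp [hHdef]
  let P : Fin D → Mspace D := fun a => (0, Pi.single a 1)
  have hHP : ∀ a, ∃ r : ℝ, α H (P a) = r • P a := fun a => by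
    obtain ⟨r, hr⟩ := exists_eq_smul_single_of_rotMap hD (α H)
      (fun b c Y => by simp [hpair, hH]) a
    exact ⟨r, by simp [P, hr, ← Pi.single_smul]⟩
  choose f hf using hHP
  have hBH : ∀ a, lorBoost a H = P a := fun a => by simp [lorBoost_apply, hHdef, P]
  have hBP : ∀ a, lorBoost a (P a) = H := fun a => by simp [lorBoost_apply, hHdef, P]
  have hBP_ne : ∀ a b, a ≠ b → lorBoost a (P b) = 0 := fun a b hab => by
    simp [lorBoost_apply, P, hab]
  have hPH : ∀ a, α (P a) H = (k - f a) • P a := fun a => by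
    have h := hboost a H H
    rw [hk, map_smul, hBH, hf] at h
    rw [sub_smul, h, add_sub_cancel_right]
  have hPP : ∀ a, α (P a) (P a) = (f a - k) • H := fun a => by
    have h := hboost a H (P a)
    rw [hf, map_smul, hBH, hBP, hk] at h
    rw [sub_smul, h, add_sub_cancel_right]
  have hPP_ne : ∀ a b, a ≠ b → α (P a) (P b) = 0 := fun a b hab => by
    have h := hboost a H (P b)
    rw [hf, map_smul, hBH, hBP_ne a b hab] at h
    simpa using h.symm
  have hfk : ∀ a, f a = 0 ∧ k = 0 := fun a => by
    have h₁ := congrArg Prod.fst (hboost a (P a) H)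
    have h₂ := congrFun (congrArg Prod.snd (hboost a (P a) (P a))) a
    rw [hPH, map_smul, hBH, hBP, hk, hPP] at h₁
    rw [hPP, map_smul, hBH, hBP, hf, hPH] at h₂
    simp [P, hHdef] at h₁ h₂
    constructor <;> linarith
  have hk0 : k = 0 := (hfk ⟨0, by omega⟩).2
  have hf0 : ∀ a, f a = 0 := fun a => (hfk a).1
  have hPP0 : ∀ a b, α (P a) (P b) = 0 := fun a b => by
    by_cases hab : a = b
    · subst hab
      simp [hPP, hf0, hk0]
    · exact hPP_ne a b hab
  have hext : ∀ g : Mspace D →ₗ[ℝ] Mspace D, g H = 0 → (∀ a, g (P a) = 0) → g = 0 :=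
    fun g hg hgP => LinearMap.prod_ext (LinearMap.ext_ring hg)
      (LinearMap.pi_ext' fun a => LinearMap.ext_ring (hgP a))
  refine LinearMap.prod_ext (LinearMap.ext_ring ?_)
    (LinearMap.pi_ext' fun a => LinearMap.ext_ring ?_)
  · exact hext (α H) (by simp [hk, hk0]) fun a => by simp [hf, hf0]
  · exact hext (α (P a)) (by simp [hPH, hk0, hf0]) (hPP0 a)
end

section
/- Let D ≥ 3 and let α : m × m → m be a bilinear map which is rotation equivariant and galilean-boost equivariant. If α is symmetric (α(X,Y) = α(Y,X) for all X,Y ∈ m) and satisfies α(X,α(Y,Z)) = α(Y,α(X,Z)) for all X,Y,Z ∈ m, then α = 0. (For the galilean spacetime G, whose Lie brackets among H, P_a all vanish in m and whose brackets [H,P_a], [P_a,P_b] vanish entirely, these two conditions are the vanishing of the torsion Θ(X,Y) = α(X,Y) − α(Y,X) and of the curvature Ω(X,Y)Z = α(X,α(Y,Z)) − α(Y,α(X,Z)); hence the canonical connection is the unique torsion-free, flat invariant connection on G.) -/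
open Matrix

/-- The galilean boost `β_a (h, p) = (0, h • e_a)`. -/
noncomputable def galBoost {D : ℕ} (a : Fin D) : Mspace D →ₗ[ℝ] Mspace D :=
  LinearMap.prod 0
    (LinearMap.toSpanSingleton ℝ (Fin D → ℝ) (Pi.single a 1) ∘ₗ
      LinearMap.fst ℝ ℝ (Fin D → ℝ))

/-- In dimension at least two, a vector annihilated by every skew-symmetric matrix is zero. -/
theorem eq_zero_of_forall_skew_mulVec_eq_zero {n R : Type*} [Fintype n] [DecidableEq n]
    [Nontrivial n] [Ring R] (v : n → R)
    (h : ∀ A : Matrix n n R, Aᵀ = -A → A *ᵥ v = 0) : v = 0 := by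
  funext i
  obtain ⟨j, hj⟩ := exists_ne i
  have hA := congrFun (h (Matrix.single j i 1 - Matrix.single i j 1) (by simp)) j
  simpa [Matrix.sub_mulVec, Matrix.single_mulVec, Function.update_of_ne hj] using hA

/-- For `D ≥ 3`, a rotation- and galilean-boost-equivariant bilinear map `α` on
`m = ℝ × ℝ^D` which is symmetric (zero torsion for the galilean spacetime `G`) and
satisfies `α(X, α(Y,Z)) = α(Y, α(X,Z))` (zero curvature) must vanish: the canonical
connection is the unique torsion-free, flat invariant connection on `G`. -/
theorem galilean_torsion_free_flat_unique (D : ℕ) (hD : 3 ≤ D)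
    (α : Mspace D →ₗ[ℝ] Mspace D →ₗ[ℝ] Mspace D)
    (hrot : ∀ Λ : Matrix (Fin D) (Fin D) ℝ, Λᵀ = -Λ → IsEquivariant (rotMap Λ) α)
    (hboost : ∀ a : Fin D, IsEquivariant (galBoost a) α)
    (hsym : ∀ X Y : Mspace D, α X Y = α Y X)
    (hflat : ∀ X Y Z : Mspace D, α X (α Y Z) = α Y (α X Z)) :
    α = 0 := by
  have : Nontrivial (Fin D) := Fin.nontrivial_iff_two_le.mpr (by omega)
  have hHH : (α (1, 0) (1, 0)).2 = 0 :=
    eq_zero_of_forall_skew_mulVec_eq_zero _ fun Λ hΛ => by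
      have h := congrArg Prod.snd (hrot Λ hΛ (1, 0) (1, 0))
      have hH : rotMap Λ ((1, 0) : Mspace D) = 0 := by simp [rotMap]
      rw [hH] at h
      simpa [rotMap] using h
  obtain ⟨c, hc⟩ : ∃ c : ℝ, α (1, 0) (1, 0) = (c, 0) := ⟨_, Prod.ext rfl hHH⟩
  have hbH (a : Fin D) : galBoost a ((1, 0) : Mspace D) = (0, Pi.single a 1) := by
    simp [galBoost]
  have hbP (a : Fin D) (p : Fin D → ℝ) : galBoost a ((0, p) : Mspace D) = 0 := by
    simp [galBoost]
  have hHP (a : Fin D) :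
      α (1, 0) (0, Pi.single a 1) = (c / 2) • ((0, Pi.single a 1) : Mspace D) := by
    have h := hboost a (1, 0) (1, 0)
    have hcH : ((c, 0) : Mspace D) = c • (1, 0) := by simp
    rw [hc, hbH, hsym (0, _), hcH, map_smul, hbH, ← two_smul ℝ] at h
    rw [div_eq_inv_mul, mul_smul, h, smul_smul]
    norm_num
  have hPP (a b : Fin D) :
      α (0, Pi.single a 1) (0, Pi.single b 1) = 0 := by
    have h := hboost a (1, 0) (0, Pi.single b 1)
    rw [hHP, map_smul, hbP, hbH, map_zero, add_zero, smul_zero] at h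
    exact h.symm
  have hc0 : c = 0 := by
    have a : Fin D := ⟨0, by omega⟩
    have h := hflat (1, 0) (0, Pi.single a 1) (1, 0)
    have hcH : ((c, 0) : Mspace D) = c • (1, 0) := by simp
    rw [hc, hcH, map_smul, hsym (0, _), hHP, map_smul, hHP] at h
    have h' := congrFun (congrArg Prod.snd h) a
    simp at h'
    rcases h' with h' | h' <;> linarith
  subst hc0
  refine LinearMap.ext_basis
    ((Module.Basis.singleton Unit ℝ).prod (Pi.basisFun ℝ (Fin D)))
    ((Module.Basis.singleton Unit ℝ).prod (Pi.basisFun ℝ (Fin D))) ?_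
  rintro (i | a) (j | b)
  · simpa [← Prod.zero_eq_mk] using hc
  · simpa using hHP b
  · simpa [hsym _ ((1 : ℝ), (0 : Fin D → ℝ))] using hHP a
  · simpa using hPP a b
end

section
/- Let D ≥ 3. For a bilinear map α : m × m → m which is rotation equivariant and galilean-boost equivariant, define (writing X = (h,p), Y = (h',p'), Z = (h'',p'') and q := h p' − h' p ∈ ℝ^D) the torsion Θ(X,Y) := α(X,Y) − α(Y,X) and the curvature Ω(X,Y)Z := α(X,α(Y,Z)) − α(Y,α(X,Z)) + (0, h'' q); these are the torsion and curvature of the invariant connection with Nomizu map α on galilean de Sitter spacetime dSG (brackets [H,B_a] = −P_a, [H,P_a] = −B_a). Then Θ ≡ 0 and Ω ≡ 0 if and only if α((h,p),(h',p')) = (2hh', hp' + h'p) or α((h,p),(h',p')) = (−2hh', −hp' − h'p); that is, dSG admits exactly two torsion-free, flat invariant connections. -/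
open Matrix

/-- `q = h p' - h' p` for `X = (h, p)`, `Y = (h', p')`. -/
noncomputable def qvec {D : ℕ} (X Y : Mspace D) : Fin D → ℝ :=
  X.1 • Y.2 - Y.1 • X.2

/-- The torsion of the invariant connection with Nomizu map `α` on galilean de Sitter
spacetime `dSG`: `Θ(X,Y) = α(X,Y) - α(Y,X)`. -/
noncomputable def torsionDSG {D : ℕ} (α : Mspace D →ₗ[ℝ] Mspace D →ₗ[ℝ] Mspace D)
    (X Y : Mspace D) : Mspace D :=
  α X Y - α Y X

/-- The curvature of the invariant connection with Nomizu map `α` on galilean de Sitter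
spacetime `dSG`: `Ω(X,Y)Z = α(X,α(Y,Z)) - α(Y,α(X,Z)) + (0, h'' q)`. -/
noncomputable def curvatureDSG {D : ℕ} (α : Mspace D →ₗ[ℝ] Mspace D →ₗ[ℝ] Mspace D)
    (X Y Z : Mspace D) : Mspace D :=
  α X (α Y Z) - α Y (α X Z) + ((0, Z.1 • qvec X Y) : Mspace D)

theorem boost_equivariance {D : ℕ} {α : Mspace D →ₗ[ℝ] Mspace D →ₗ[ℝ] Mspace D}
    (hboost : ∀ a : Fin D, IsEquivariant (galBoost a) α) (Y Z : Mspace D) (p : Fin D → ℝ) :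
    ((0, (α Y Z).1 • p) : Mspace D) = α (0, Y.1 • p) Z + α Y (0, Z.1 • p) := by
  have hsmul (c : ℝ) (q : Fin D → ℝ) : ((0, c • q) : Mspace D) = c • ((0, q) : Mspace D) := by
    simp
  let inr := LinearMap.inr ℝ ℝ (Fin D → ℝ)
  have key : (α Y Z).1 • inr = Y.1 • (α.flip Z ∘ₗ inr) + Z.1 • (α Y ∘ₗ inr) := by
    refine LinearMap.pi_ext' fun a => LinearMap.ext_ring ?_
    have hg (X : Mspace D) : galBoost a X = X.1 • ((0, Pi.single a 1) : Mspace D) := by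
      simp [galBoost]
    have h := hboost a Y Z
    rw [hg, hg, hg, map_smul, map_smul, LinearMap.smul_apply] at h
    exact h
  rw [hsmul, hsmul, hsmul, map_smul, map_smul, LinearMap.smul_apply]
  exact LinearMap.congr_fun key p

theorem eq_zero_of_rotMap_eq_zero {D : ℕ} (hD : 2 ≤ D) (v : Mspace D)
    (hv : ∀ Λ : Matrix (Fin D) (Fin D) ℝ, Λᵀ = -Λ → rotMap Λ v = 0) : v.2 = 0 := by
  have : Nontrivial (Fin D) := Fin.nontrivial_iff_two_le.mpr hD
  funext i
  obtain ⟨j, hj⟩ := exists_ne i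
  have h := hv (Matrix.single j i 1 - Matrix.single i j 1) (by simp)
  have h' := congrFun (congrArg Prod.snd h) j
  simpa [rotMap, Matrix.sub_mulVec, Matrix.single_mulVec, hj] using h'

/-- A symmetric equivariant bilinear map is determined by the `H`-component of `α(H, H)`. -/
theorem equivariant_symmetric_apply {D : ℕ} (hD : 2 ≤ D)
    {α : Mspace D →ₗ[ℝ] Mspace D →ₗ[ℝ] Mspace D}
    (hrot : ∀ Λ : Matrix (Fin D) (Fin D) ℝ, Λᵀ = -Λ → IsEquivariant (rotMap Λ) α)
    (hboost : ∀ a : Fin D, IsEquivariant (galBoost a) α)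
    (hsymm : ∀ X Y : Mspace D, α X Y = α Y X) :
    ∃ c : ℝ, ∀ v w : Mspace D,
      α v w = ((c * (2 * (v.1 * w.1)), c • (v.1 • w.2 + w.1 • v.2)) : Mspace D) := by
  have hu : (α (1, 0) (1, 0)).2 = 0 := by
    refine eq_zero_of_rotMap_eq_zero hD _ fun Λ hΛ => ?_
    have hH : rotMap Λ ((1, 0) : Mspace D) = 0 := by simp [rotMap]
    rw [hrot Λ hΛ, hH]
    simp
  obtain ⟨c, hc⟩ : ∃ c, α (1, 0) (1, 0) = ((2 * c, 0) : Mspace D) :=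
    ⟨(α (1, 0) (1, 0)).1 / 2, Prod.ext (by ring) hu⟩
  have hHP (p : Fin D → ℝ) : α (1, 0) (0, p) = ((0, c • p) : Mspace D) := by
    have h := boost_equivariance hboost (1, 0) (1, 0) p
    rw [hc, hsymm (0, _)] at h
    simp only [one_smul] at h
    rw [← two_smul ℝ] at h
    have h' := congrArg (fun x => (2⁻¹ : ℝ) • x) h
    simpa [smul_smul] using h'.symm
  have hPP (p r : Fin D → ℝ) : α (0, p) (0, r) = (0 : Mspace D) := by
    have h := boost_equivariance hboost (1, 0) (0, r) p
    rw [hHP] at h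
    simpa [Prod.mk_zero_zero] using h.symm
  refine ⟨c, fun v w => ?_⟩
  have hdecomp (x : Mspace D) : x = x.1 • ((1, 0) : Mspace D) + ((0, x.2) : Mspace D) := by
    simp
  conv_lhs => rw [hdecomp v, hdecomp w]
  simp only [map_add, map_smul, LinearMap.add_apply, LinearMap.smul_apply, hc, hHP, hPP,
    hsymm (0, v.2) (1, 0)]
  ext <;> simp <;> ring

theorem curvatureDSG_of_scaled {D : ℕ} {α : Mspace D →ₗ[ℝ] Mspace D →ₗ[ℝ] Mspace D} {c : ℝ}
    (hα : ∀ v w : Mspace D,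
      α v w = ((c * (2 * (v.1 * w.1)), c • (v.1 • w.2 + w.1 • v.2)) : Mspace D))
    (X Y Z : Mspace D) :
    curvatureDSG α X Y Z = ((0, ((1 - c ^ 2) * Z.1) • qvec X Y) : Mspace D) := by
  simp only [curvatureDSG, hα, qvec]
  ext <;> simp <;> ring

theorem torsionDSG_of_scaled {D : ℕ} {α : Mspace D →ₗ[ℝ] Mspace D →ₗ[ℝ] Mspace D} {c : ℝ}
    (hα : ∀ v w : Mspace D,
      α v w = ((c * (2 * (v.1 * w.1)), c • (v.1 • w.2 + w.1 • v.2)) : Mspace D))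
    (X Y : Mspace D) : torsionDSG α X Y = 0 := by
  simp only [torsionDSG, hα]
  ext <;> simp <;> ring

/-- For `D ≥ 3` and a rotation- and galilean-boost-equivariant bilinear map `α`, the
associated invariant connection on galilean de Sitter spacetime `dSG` is torsion-free
and flat if and only if `α((h,p),(h',p')) = (2hh', hp' + h'p)` or
`α((h,p),(h',p')) = (-2hh', -hp' - h'p)`:  `dSG` admits exactly two torsion-free, flat
invariant connections. -/
theorem dSG_torsion_free_flat_connections (D : ℕ) (hD : 3 ≤ D)
    (α : Mspace D →ₗ[ℝ] Mspace D →ₗ[ℝ] Mspace D)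
    (hrot : ∀ Λ : Matrix (Fin D) (Fin D) ℝ, Λᵀ = -Λ → IsEquivariant (rotMap Λ) α)
    (hboost : ∀ a : Fin D, IsEquivariant (galBoost a) α) :
    ((∀ X Y : Mspace D, torsionDSG α X Y = 0) ∧
      (∀ X Y Z : Mspace D, curvatureDSG α X Y Z = 0))
    ↔ ((∀ v w : Mspace D, α v w = ((2 * (v.1 * w.1), v.1 • w.2 + w.1 • v.2) : Mspace D)) ∨
        (∀ v w : Mspace D,
          α v w = ((-(2 * (v.1 * w.1)), -(v.1 • w.2) - w.1 • v.2) : Mspace D))) := by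
  constructor
  · rintro ⟨htor, hcurv⟩
    obtain ⟨c, hα⟩ := equivariant_symmetric_apply (by omega) hrot hboost
      fun X Y => sub_eq_zero.mp (htor X Y)
    have h := hcurv (1, 0) (0, 1) (1, 0)
    rw [curvatureDSG_of_scaled hα] at h
    have h' := congrFun (congrArg Prod.snd h) ⟨0, by omega⟩
    have hc : c ^ 2 = 1 := by
      simp [qvec] at h'
      linarith
    rcases (by simpa using hc : c = 1 ∨ c = -1) with rfl | rfl
    · exact Or.inl fun v w => by simp [hα]
    · exact Or.inr fun v w => by simp [hα, sub_eq_add_neg]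
  · intro h
    obtain ⟨c, hc, hα⟩ : ∃ c : ℝ, c ^ 2 = 1 ∧ ∀ v w : Mspace D,
        α v w = ((c * (2 * (v.1 * w.1)), c • (v.1 • w.2 + w.1 • v.2)) : Mspace D) := by
      rcases h with h | h
      · exact ⟨1, by norm_num, fun v w => by simp [h]⟩
      · exact ⟨-1, by norm_num, fun v w => by simp [h, sub_eq_add_neg]⟩
    refine ⟨torsionDSG_of_scaled hα, fun X Y Z => ?_⟩
    rw [curvatureDSG_of_scaled hα, hc]
    simp
end

section
/- Let D = 2, γ ∈ [−1,1) and χ ≠ 0. Let J : ℝ² → ℝ² be the rotation J(q₁,q₂) = (−q₂,q₁). For a bilinear map α : m × m → m which is rotation equivariant and galilean-boost equivariant, define (writing X = (h,p), Y = (h',p'), Z = (h'',p'') and q := h p' − h' p ∈ ℝ²) the torsion Θ(X,Y) := α(X,Y) − α(Y,X) − (0, (1+γ) q − χ J q) and the curvature Ω(X,Y)Z := α(X,α(Y,Z)) − α(Y,α(X,Z)) − α((0,(1+γ)q − χ J q), Z) − (0, h''(γ q − χ J q)); these are the torsion and curvature of the invariant connection with Nomizu map α on the three-dimensional galilean spacetime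 S12_{γ,χ} (brackets [H,B_a] = −P_a, [H,P_a] = (1+γ)P_a − χ ε_{ab}P_b + γ B_a − χ ε_{ab} B_b). Then there is no such α with Θ ≡ 0 and Ω ≡ 0; that is, S12_{γ,χ} admits no torsion-free, flat invariant connection. -/
open Matrix

/-- The rotation `J (q₁, q₂) = (-q₂, q₁)` of `ℝ²`. -/
noncomputable def Jrot (q : Fin 2 → ℝ) : Fin 2 → ℝ := ![-(q 1), q 0]

/-- The torsion of the invariant connection with Nomizu map `α` on the three-dimensional
galilean spacetime `S12_{γ,χ}`: `Θ(X,Y) = α(X,Y) - α(Y,X) - (0, (1+γ) q - χ J q)`. -/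
noncomputable def torsionS12 (γ χ : ℝ)
    (α : Mspace 2 →ₗ[ℝ] Mspace 2 →ₗ[ℝ] Mspace 2) (X Y : Mspace 2) : Mspace 2 :=
  α X Y - α Y X - ((0, (1 + γ) • qvec X Y - χ • Jrot (qvec X Y)) : Mspace 2)

/-- The curvature of the invariant connection with Nomizu map `α` on the
three-dimensional galilean spacetime `S12_{γ,χ}`:
`Ω(X,Y)Z = α(X,α(Y,Z)) - α(Y,α(X,Z)) - α((0, (1+γ)q - χ J q), Z) - (0, h''(γ q - χ J q))`. -/
noncomputable def curvatureS12 (γ χ : ℝ)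
    (α : Mspace 2 →ₗ[ℝ] Mspace 2 →ₗ[ℝ] Mspace 2) (X Y Z : Mspace 2) : Mspace 2 :=
  α X (α Y Z) - α Y (α X Z)
    - α ((0, (1 + γ) • qvec X Y - χ • Jrot (qvec X Y)) : Mspace 2) Z
    - ((0, Z.1 • (γ • qvec X Y - χ • Jrot (qvec X Y))) : Mspace 2)

/-- Decomposition of an element of `m = ℝ × ℝ²` in the basis `H, P₀, P₁`. -/
theorem mspace_two_eq (x : Mspace 2) :
    x = x.1 • ((1, 0) : Mspace 2) + x.2 0 • ((0, ![1, 0]) : Mspace 2)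
      + x.2 1 • ((0, ![0, 1]) : Mspace 2) := by
  refine Prod.ext (by simp) ?_
  ext i
  fin_cases i <;> simp

/-- For `γ ∈ [-1,1)` and `χ ≠ 0`, there is no rotation- and galilean-boost-equivariant
bilinear map `α` whose associated invariant connection on the galilean spacetime
`S12_{γ,χ}` is both torsion-free and flat: `S12_{γ,χ}` admits no torsion-free, flat
invariant connection. -/
theorem S12_no_torsion_free_flat_connection (γ χ : ℝ)
    (hγ₁ : -1 ≤ γ) (hγ₂ : γ < 1) (hχ : χ ≠ 0) :
    ¬ ∃ α : Mspace 2 →ₗ[ℝ] Mspace 2 →ₗ[ℝ] Mspace 2,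
      (∀ Λ : Matrix (Fin 2) (Fin 2) ℝ, Λᵀ = -Λ → IsEquivariant (rotMap Λ) α) ∧
      (∀ a : Fin 2, IsEquivariant (galBoost a) α) ∧
      (∀ X Y : Mspace 2, torsionS12 γ χ α X Y = 0) ∧
      (∀ X Y Z : Mspace 2, curvatureS12 γ χ α X Y Z = 0) := by
  rintro ⟨α, hrot, hboost, htor, hcurv⟩
  have hΛ : (!![0, -1; 1, 0] : Matrix (Fin 2) (Fin 2) ℝ)ᵀ = -!![0, -1; 1, 0] := by
    ext i j
    fin_cases i <;> fin_cases j <;> simp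
  have hR := hrot _ hΛ
  have hρH : rotMap !![0, -1; 1, 0] ((1, 0) : Mspace 2) = 0 := by simp [rotMap]
  have hρP : rotMap !![0, -1; 1, 0] ((0, ![1, 0]) : Mspace 2) = (0, ![0, 1]) := by
    refine Prod.ext (by simp [rotMap]) ?_
    ext i
    fin_cases i <;> simp [rotMap]
  have hβH : galBoost 0 ((1, 0) : Mspace 2) = (0, ![1, 0]) := by
    refine Prod.ext (by simp [galBoost]) ?_
    ext i
    fin_cases i <;> simp [galBoost]
  have hHH := hR (1, 0) (1, 0)
  have hHP := hR (1, 0) (0, ![1, 0])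
  have hPH := hR (0, ![1, 0]) (1, 0)
  have hB := hboost 0 (1, 0) (1, 0)
  have hT := htor (1, 0) (0, ![1, 0])
  have hC := hcurv (1, 0) (0, ![1, 0]) (1, 0)
  rw [hρH] at hHH hHP hPH
  rw [hρP] at hHP hPH
  rw [hβH] at hB
  simp only [map_zero, LinearMap.zero_apply, zero_add, add_zero] at hHH hHP hPH
  have hq : ((0, (1 + γ) • qvec (1, 0) (0, ![1, 0]) - χ • Jrot (qvec (1, 0) (0, ![1, 0])))
      : Mspace 2) = (1 + γ) • ((0, ![1, 0]) : Mspace 2) - χ • ((0, ![0, 1]) : Mspace 2) := by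
    refine Prod.ext (by simp) ?_
    ext i
    fin_cases i <;> simp [qvec, Jrot]
  rw [torsionS12, hq] at hT
  rw [curvatureS12, hq] at hC
  rw [mspace_two_eq (α (0, ![1, 0]) (1, 0)), mspace_two_eq (α (1, 0) (1, 0))] at hC
  simp only [map_add, map_sub, map_smul, LinearMap.sub_apply, LinearMap.smul_apply,
    ← hHP, ← hPH] at hC
  generalize α (1, 0) (1, 0) = u at *
  generalize α (1, 0) (0, ![1, 0]) = v at *
  generalize α (0, ![1, 0]) (1, 0) = w at *
  generalize α (0, ![1, 0]) (0, ![1, 0]) = a at *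
  generalize α (0, ![1, 0]) (0, ![0, 1]) = b at *
  have hu0 := congrFun (congrArg Prod.snd hHH) 0
  have hu1 := congrFun (congrArg Prod.snd hHH) 1
  have hB' := congrArg Prod.fst hB
  have hB0 := congrFun (congrArg Prod.snd hB) 0
  have hB1 := congrFun (congrArg Prod.snd hB) 1
  have hT' := congrArg Prod.fst hT
  have hT0 := congrFun (congrArg Prod.snd hT) 0
  have hT1 := congrFun (congrArg Prod.snd hT) 1
  have hC1 := congrFun (congrArg Prod.snd hC) 1
  simp [rotMap, vecHead, vecTail] at hu0 hu1
  simp [galBoost] at hB' hB0 hB1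
  simp at hT' hT0 hT1
  simp [rotMap, qvec, Jrot, vecHead, vecTail, hu0, hu1] at hC1
  have hv0 : v.2 0 = w.2 0 + (1 + γ) := by linarith
  have hv1 : v.2 1 = -χ / 2 := by linarith
  have hw1 : w.2 1 = χ / 2 := by linarith
  rw [hB0, hv0, hv1, hw1] at hC1
  have key : χ * (1 - γ) = 0 := by linear_combination 2 * hC1
  rcases mul_eq_zero.1 key with h | h
  · exact hχ h
  · linarith
end

section
/- Let D ≥ 3 and ϰ ∈ {1,−1}. For every bilinear map α : m × m → m which is rotation equivariant and carrollian-boost equivariant, the torsion Θ(X,Y) := α(X,Y) − α(Y,X) of the invariant connection with Nomizu map α on the carrollian (anti) de Sitter spacetime vanishes identically, while its curvature is independent of α and given explicitly, for X = (h,p), Y = (h',p'), Z = (h'',p''), by Ω(X,Y)Z = ϰ·( h⟨p',p''⟩ − h'⟨p,p''⟩ , ⟨p',p''⟩ p − ⟨p,p''⟩ p' ); in particular Ω(H,P_a)P_a = ϰ H ≠ 0, so carrollian de Sitter (ϰ = 1) and carrollian anti de Sitter (ϰ = −1) spacetimes admit no flat invariant connection, and every invariant connection on them is torsion-free. -/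
open Matrix

/-- The carrollian boost `β_a (h, p) = (p_a, 0)`. -/
noncomputable def carBoost {D : ℕ} (a : Fin D) : Mspace D →ₗ[ℝ] Mspace D :=
  LinearMap.prod (LinearMap.proj a ∘ₗ LinearMap.snd ℝ ℝ (Fin D → ℝ)) 0

/-- The tensor `ϰ·(h⟨p',p''⟩ - h'⟨p,p''⟩, ⟨p',p''⟩ p - ⟨p,p''⟩ p')` appearing in the
curvature of the carrollian (anti) de Sitter spacetimes; it is (minus) the linear
isotropy action of `[X,Y]_h` on `Z`, computed from the brackets `[H,P_a] = -ϰ B_a`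
and `[P_a,P_b] = -ϰ J_{ab}`. -/
noncomputable def carCurvTensor {D : ℕ} (ϰ : ℝ) (X Y Z : Mspace D) : Mspace D :=
  ϰ • ((X.1 * (Y.2 ⬝ᵥ Z.2) - Y.1 * (X.2 ⬝ᵥ Z.2),
      (Y.2 ⬝ᵥ Z.2) • X.2 - (X.2 ⬝ᵥ Z.2) • Y.2) : Mspace D)

/-- The curvature of the invariant connection with Nomizu map `α` on the carrollian
(anti) de Sitter spacetime: `Ω(X,Y)Z = α(X,α(Y,Z)) - α(Y,α(X,Z)) - [[X,Y]_h, Z]`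
where `[X,Y]_m = 0` and `-[[X,Y]_h, Z]` is the tensor `carCurvTensor`. -/
noncomputable def curvatureCarDS {D : ℕ} (ϰ : ℝ)
    (α : Mspace D →ₗ[ℝ] Mspace D →ₗ[ℝ] Mspace D) (X Y Z : Mspace D) : Mspace D :=
  α X (α Y Z) - α Y (α X Z) + carCurvTensor ϰ X Y Z

/-- The generator `H` of `m`. -/
noncomputable abbrev genH (D : ℕ) : Mspace D := (1, 0)

/-- The generators `P a` of `m`. -/
noncomputable abbrev genP {D : ℕ} (a : Fin D) : Mspace D := (0, Pi.single a 1)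

/-- The generator of rotations in the plane spanned by `e a` and `e b`. -/
noncomputable def planeRot {D : ℕ} (a b : Fin D) : Matrix (Fin D) (Fin D) ℝ :=
  Matrix.single b a 1 - Matrix.single a b 1

lemma planeRot_transpose {D : ℕ} (a b : Fin D) : (planeRot a b)ᵀ = -planeRot a b := by
  simp [planeRot]

lemma rotMap_genH {D : ℕ} (Λ : Matrix (Fin D) (Fin D) ℝ) : rotMap Λ (genH D) = 0 := by
  simp [rotMap]

lemma rotMap_smul_genH {D : ℕ} (Λ : Matrix (Fin D) (Fin D) ℝ) (t : ℝ) :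
    rotMap Λ ((t, 0) : Mspace D) = 0 := by
  simp [rotMap]

lemma rotMap_planeRot_left {D : ℕ} {a b : Fin D} (h : a ≠ b) :
    rotMap (planeRot a b) (genP a) = genP b := by
  ext i
  · simp [rotMap]
  · simp [rotMap, planeRot, Matrix.single_apply, Pi.single_apply, h.symm, eq_comm]

lemma rotMap_planeRot_of_ne {D : ℕ} {a b c : Fin D} (ha : c ≠ a) (hb : c ≠ b) :
    rotMap (planeRot a b) (genP c) = 0 := by
  ext i
  · simp [rotMap]
  · simp [rotMap, planeRot, ha.symm, hb.symm]

/-- The boost equivariance condition, spelled out. -/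
lemma boost_apply {D : ℕ} {α : Mspace D →ₗ[ℝ] Mspace D →ₗ[ℝ] Mspace D}
    (hboost : ∀ a : Fin D, IsEquivariant (carBoost a) α) (a : Fin D) (Y Z : Mspace D) :
    (((α Y Z).2 a, 0) : Mspace D) = Y.2 a • α (genH D) Z + Z.2 a • α Y (genH D) := by
  have key (W : Mspace D) : carBoost a W = W.2 a • genH D := by
    ext <;> simp [carBoost]
  have h := hboost a Y Z
  rw [key Y, key Z, map_smul, map_smul, LinearMap.smul_apply] at h
  rw [← h]
  ext <;> simp [carBoost]

/-- Linear maps out of `m` agree as soon as they agree on the generators. -/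
lemma linearMap_ext_gen {D : ℕ} {N : Type*} [AddCommMonoid N] [Module ℝ N]
    {f g : Mspace D →ₗ[ℝ] N} (hH : f (genH D) = g (genH D))
    (hP : ∀ a, f (genP a) = g (genP a)) : f = g := by
  apply LinearMap.prod_ext
  · ext
    simpa using hH
  · ext a
    simpa using hP a

section

variable {D : ℕ} {α : Mspace D →ₗ[ℝ] Mspace D →ₗ[ℝ] Mspace D}

lemma equivariant_genH_genH (hD : 2 ≤ D)
    (hboost : ∀ a : Fin D, IsEquivariant (carBoost a) α) : α (genH D) (genH D) = 0 := by
  have : Nontrivial (Fin D) := Fin.nontrivial_iff_two_le.mpr hD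
  obtain ⟨a, b, hab⟩ := exists_pair_ne (Fin D)
  have h1 := boost_apply hboost a (genP a) (genH D)
  have h2 := boost_apply hboost b (genP a) (genP b)
  simp only [Pi.single_eq_same, Pi.single_eq_of_ne hab.symm, Pi.zero_apply, one_smul, zero_smul,
    zero_add, add_zero] at h1 h2
  rw [← h1, ← h2]
  rfl

lemma equivariant_genH_left (hD : 2 ≤ D)
    (hrot : ∀ Λ : Matrix (Fin D) (Fin D) ℝ, Λᵀ = -Λ → IsEquivariant (rotMap Λ) α)
    (hboost : ∀ a : Fin D, IsEquivariant (carBoost a) α) : α (genH D) = 0 := by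
  have : Nontrivial (Fin D) := Fin.nontrivial_iff_two_le.mpr hD
  refine linearMap_ext_gen (equivariant_genH_genH hD hboost) fun b ↦ ?_
  obtain ⟨a, hab⟩ := exists_ne b
  have hb := boost_apply hboost b (genP b) (genP a)
  have hr := hrot _ (planeRot_transpose a b) (genH D) (genP a)
  simp only [Pi.single_eq_same, Pi.single_eq_of_ne hab.symm, one_smul, zero_smul,
    add_zero] at hb
  rw [← hb, rotMap_smul_genH, rotMap_genH, rotMap_planeRot_left hab] at hr
  simpa using hr.symm

lemma equivariant_genH_right (hD : 2 ≤ D)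
    (hrot : ∀ Λ : Matrix (Fin D) (Fin D) ℝ, Λᵀ = -Λ → IsEquivariant (rotMap Λ) α)
    (hboost : ∀ a : Fin D, IsEquivariant (carBoost a) α) (Y : Mspace D) :
    α Y (genH D) = 0 := by
  have hflip : α.flip (genH D) = 0 :=
    equivariant_genH_left (α := α.flip) hD
      (fun Λ hΛ Y Z ↦ by simpa [add_comm] using hrot Λ hΛ Z Y)
      (fun a Y Z ↦ by simpa [add_comm] using hboost a Z Y)
  simpa using LinearMap.congr_fun hflip Y

/-- An equivariant bilinear map takes its values in the line spanned by `H`. -/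
lemma equivariant_snd (hD : 2 ≤ D)
    (hrot : ∀ Λ : Matrix (Fin D) (Fin D) ℝ, Λᵀ = -Λ → IsEquivariant (rotMap Λ) α)
    (hboost : ∀ a : Fin D, IsEquivariant (carBoost a) α) (Y Z : Mspace D) :
    (α Y Z).2 = 0 := by
  ext a
  have h := boost_apply hboost a Y Z
  rw [equivariant_genH_left hD hrot hboost, equivariant_genH_right hD hrot hboost] at h
  simpa using congrArg Prod.fst h

lemma equivariant_eq_smul_genH (hD : 2 ≤ D)
    (hrot : ∀ Λ : Matrix (Fin D) (Fin D) ℝ, Λᵀ = -Λ → IsEquivariant (rotMap Λ) α)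
    (hboost : ∀ a : Fin D, IsEquivariant (carBoost a) α) (Y Z : Mspace D) :
    α Y Z = (α Y Z).1 • genH D := by
  ext1
  · simp
  · simp [equivariant_snd hD hrot hboost]

lemma equivariant_apply_apply (hD : 2 ≤ D)
    (hrot : ∀ Λ : Matrix (Fin D) (Fin D) ℝ, Λᵀ = -Λ → IsEquivariant (rotMap Λ) α)
    (hboost : ∀ a : Fin D, IsEquivariant (carBoost a) α) (X Y Z : Mspace D) :
    α X (α Y Z) = 0 := by
  rw [equivariant_eq_smul_genH hD hrot hboost Y Z, map_smul,
    equivariant_genH_right hD hrot hboost, smul_zero]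

lemma equivariant_genP_genP_of_ne (hD : 3 ≤ D)
    (hrot : ∀ Λ : Matrix (Fin D) (Fin D) ℝ, Λᵀ = -Λ → IsEquivariant (rotMap Λ) α)
    (hboost : ∀ a : Fin D, IsEquivariant (carBoost a) α) {b c : Fin D} (hbc : b ≠ c) :
    α (genP b) (genP c) = 0 := by
  have hcard : ({b, c} : Finset (Fin D)).card < Fintype.card (Fin D) :=
    Finset.card_le_two.trans_lt (by rw [Fintype.card_fin]; omega)
  obtain ⟨a, ha⟩ := Finset.exists_mem_notMem_of_card_lt_card (t := Finset.univ) hcard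
  replace ha := ha.2
  simp only [Finset.mem_insert, Finset.mem_singleton, not_or] at ha
  have h := hrot _ (planeRot_transpose a b) (genP a) (genP c)
  rw [equivariant_eq_smul_genH (by omega) hrot hboost (genP a), map_smul, rotMap_genH,
    rotMap_planeRot_left ha.1, rotMap_planeRot_of_ne (Ne.symm ha.2) hbc.symm] at h
  simpa using h.symm

lemma equivariant_flip_eq (hD : 3 ≤ D)
    (hrot : ∀ Λ : Matrix (Fin D) (Fin D) ℝ, Λᵀ = -Λ → IsEquivariant (rotMap Λ) α)
    (hboost : ∀ a : Fin D, IsEquivariant (carBoost a) α) : α.flip = α := by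
  have hl := equivariant_genH_left (by omega) hrot hboost
  have hr := equivariant_genH_right (by omega) hrot hboost
  refine linearMap_ext_gen ?_ fun a ↦ linearMap_ext_gen ?_ fun b ↦ ?_
  · refine LinearMap.ext fun Y ↦ ?_
    rw [LinearMap.flip_apply, hr, hl, LinearMap.zero_apply]
  · rw [LinearMap.flip_apply, hr, hl, LinearMap.zero_apply]
  · rw [LinearMap.flip_apply]
    obtain rfl | hab := eq_or_ne a b
    · rfl
    · rw [equivariant_genP_genP_of_ne hD hrot hboost hab,
        equivariant_genP_genP_of_ne hD hrot hboost hab.symm]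

end

/-- For `D ≥ 3` and `ϰ = ±1`, every rotation- and carrollian-boost-equivariant bilinear
map `α` determines a torsion-free invariant connection on the carrollian (anti) de Sitter
spacetime (`dSC` for `ϰ = 1`, `AdSC` for `ϰ = -1`), whose curvature is independent of `α`
and given by `Ω(X,Y)Z = ϰ·(h⟨p',p''⟩ - h'⟨p,p''⟩, ⟨p',p''⟩ p - ⟨p,p''⟩ p')`; in
particular `Ω(H,P_a)P_a = ϰ H ≠ 0`, so these spacetimes admit no flat invariant
connection. -/
theorem carrollian_dS_AdS_torsion_free_not_flat (D : ℕ) (hD : 3 ≤ D)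
    (ϰ : ℝ) (hϰ : ϰ = 1 ∨ ϰ = -1)
    (α : Mspace D →ₗ[ℝ] Mspace D →ₗ[ℝ] Mspace D)
    (hrot : ∀ Λ : Matrix (Fin D) (Fin D) ℝ, Λᵀ = -Λ → IsEquivariant (rotMap Λ) α)
    (hboost : ∀ a : Fin D, IsEquivariant (carBoost a) α) :
    (∀ X Y : Mspace D, α X Y - α Y X = 0) ∧
    (∀ X Y Z : Mspace D, curvatureCarDS ϰ α X Y Z = carCurvTensor ϰ X Y Z) ∧
    (∀ a : Fin D,
      curvatureCarDS ϰ α ((1, 0) : Mspace D) ((0, Pi.single a 1) : Mspace D)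
          ((0, Pi.single a 1) : Mspace D) ≠ 0) := by
  have hcurv (X Y Z : Mspace D) : curvatureCarDS ϰ α X Y Z = carCurvTensor ϰ X Y Z := by
    simp only [curvatureCarDS, equivariant_apply_apply (by omega) hrot hboost, sub_zero, zero_add]
  refine ⟨fun X Y ↦ ?_, hcurv, fun a h ↦ ?_⟩
  · rw [sub_eq_zero, ← LinearMap.flip_apply, equivariant_flip_eq hD hrot hboost]
  · rw [hcurv] at h
    have hzero : ϰ = 0 := by simpa [carCurvTensor] using congrArg Prod.fst h
    rcases hϰ with rfl | rfl <;> norm_num at hzero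
end

section
/- Let D ≥ 2 and let ξ⁰ : ℝ × ℝ^D → ℝ and ξ = (ξ¹,…,ξ^D) : ℝ × ℝ^D → ℝ^D be smooth. Then ξ⁰, ξ satisfy the carrollian Killing equations of the flat carrollian spacetime, namely ∂ξ⁰/∂t = 0, ∂ξ^a/∂t = 0 for all a, and ∂ξ^a/∂x^b + ∂ξ^b/∂x^a = 0 for all a,b, if and only if there exist a smooth function T : ℝ^D → ℝ, a vector v ∈ ℝ^D and a skew-symmetric real D×D matrix Λ such that ξ⁰(t,x) = T(x) and ξ^a(t,x) = v^a + Σ_b Λ^a_b x^b for all (t,x). (Hence the carrollian Killing vector fields of the carrollian spacetime C are exactly ξ = T(x)∂_t + ξ_X with X in the euclidean algebra, realising the semidirect product 𝔢(D) ⋉ C^∞(ℝ^D).) -/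
open Matrix

/-- A differentiable function on `ℝ × E` whose derivative in the first direction vanishes does not
depend on the first variable. -/
theorem eq_of_fderiv_fst_eq_zero {E F : Type*} [NormedAddCommGroup E] [NormedSpace ℝ E]
    [NormedAddCommGroup F] [NormedSpace ℝ F] {f : ℝ × E → F} (hf : Differentiable ℝ f)
    (h : ∀ p, fderiv ℝ f p ((1 : ℝ), (0 : E)) = 0) (s t : ℝ) (x : E) : f (s, x) = f (t, x) := by
  have hd (r : ℝ) : HasDerivAt (fun r : ℝ => f (r, x)) 0 r := by
    have := (hf (r, x)).hasFDerivAt.comp_hasDerivAt r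
      ((hasDerivAt_id r).prodMk (hasDerivAt_const r x))
    rwa [h] at this
  exact is_const_of_deriv_eq_zero (fun r => (hd r).differentiableAt) (fun r => (hd r).deriv) s t

/-- A trilinear array which is symmetric in its first two indices and skew in its last two
vanishes. -/
theorem eq_zero_of_symm_of_skew {ι : Type*} {c : ι → ι → ι → ℝ}
    (hsymm : ∀ i j k, c i j k = c j i k) (hskew : ∀ i j k, c i j k + c i k j = 0) (i j k : ι) :
    c i j k = 0 := by
  linarith [hsymm i j k, hskew j i k, hsymm j k i, hskew k j i, hsymm k i j, hskew i k j]

/-- The derivative of a `C²` euclidean Killing vector field is constant. -/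
theorem fderiv_fderiv_eq_zero_of_skew {ι : Type*} [Fintype ι] [DecidableEq ι]
    {f : (ι → ℝ) → (ι → ℝ)} (hf : ContDiff ℝ 2 f)
    (h : ∀ x a b, fderiv ℝ f x (Pi.single b 1) a + fderiv ℝ f x (Pi.single a 1) b = 0)
    (x : ι → ℝ) : fderiv ℝ (fderiv ℝ f) x = 0 := by
  have hdf : DifferentiableAt ℝ (fderiv ℝ f) x :=
    (hf.fderiv_right (m := 1) (by norm_num)).differentiable (by norm_num) x
  have hcoord (b a : ι) : HasFDerivAt (fun y => fderiv ℝ f y (Pi.single b 1) a)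
      ((ContinuousLinearMap.proj (R := ℝ) (φ := fun _ : ι => ℝ) a).comp
        ((fderiv ℝ (fderiv ℝ f) x).flip (Pi.single b 1))) x := by
    have hb : HasFDerivAt (fun y => fderiv ℝ f y (Pi.single b 1))
        ((fderiv ℝ (fderiv ℝ f) x).flip (Pi.single b 1)) x := by
      simpa using hdf.hasFDerivAt.clm_apply (hasFDerivAt_const (Pi.single b (1 : ℝ)) x)
    exact hasFDerivAt_pi'.1 hb a
  have hskew (u : ι → ℝ) (b a : ι) : fderiv ℝ (fderiv ℝ f) x u (Pi.single b 1) a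
      + fderiv ℝ (fderiv ℝ f) x u (Pi.single a 1) b = 0 := by
    have hsum := (hcoord b a).add (hcoord a b)
    have hzero : ((fun y => fderiv ℝ f y (Pi.single b 1) a)
        + fun y => fderiv ℝ f y (Pi.single a 1) b) = fun _ => (0 : ℝ) := funext fun y => h y a b
    rw [hzero] at hsum
    simpa using DFunLike.congr_fun (hsum.unique (hasFDerivAt_const (0 : ℝ) x)) u
  have hsymm : IsSymmSndFDerivAt ℝ f x := hf.contDiffAt.isSymmSndFDerivAt (by simp)
  have hc := eq_zero_of_symm_of_skew
    (c := fun i j k => fderiv ℝ (fderiv ℝ f) x (Pi.single i 1) (Pi.single j 1) k)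
    (fun i j k => congrFun (hsymm.eq _ _) k) (fun i j k => hskew _ j k)
  refine ContinuousLinearMap.coe_injective ((Pi.basisFun ℝ ι).ext fun i => ?_)
  refine ContinuousLinearMap.coe_injective ((Pi.basisFun ℝ ι).ext fun j => ?_)
  ext k
  simpa using hc i j k

/-- A `C²` euclidean Killing vector field is affine, with skew-symmetric linear part. -/
theorem exists_eq_add_mulVec_of_skew {ι : Type*} [Fintype ι] [DecidableEq ι]
    {f : (ι → ℝ) → (ι → ℝ)} (hf : ContDiff ℝ 2 f)
    (h : ∀ x a b, fderiv ℝ f x (Pi.single b 1) a + fderiv ℝ f x (Pi.single a 1) b = 0) :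
    ∃ (v : ι → ℝ) (Λ : Matrix ι ι ℝ), Λᵀ = -Λ ∧ ∀ x, f x = v + Λ *ᵥ x := by
  have hconst : ∀ x, fderiv ℝ f x = fderiv ℝ f 0 := fun x =>
    is_const_of_fderiv_eq_zero ((hf.fderiv_right (m := 1) (by norm_num)).differentiable
      (by norm_num)) (fderiv_fderiv_eq_zero_of_skew hf h) x 0
  set L := fderiv ℝ f 0
  have hsub (x : ι → ℝ) : HasFDerivAt (fun y => f y - L y) (0 : (ι → ℝ) →L[ℝ] (ι → ℝ)) x := by
    have := (hf.differentiable (by norm_num) x).hasFDerivAt.sub L.hasFDerivAt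
    rwa [hconst, sub_self] at this
  refine ⟨f 0, LinearMap.toMatrix' (L : (ι → ℝ) →ₗ[ℝ] (ι → ℝ)), ?_, fun x => ?_⟩
  · ext a b
    simpa [LinearMap.toMatrix'_apply] using eq_neg_of_add_eq_zero_left (h 0 b a)
  · have hx := is_const_of_fderiv_eq_zero (fun y => (hsub y).differentiableAt)
      (fun y => (hsub y).fderiv) x 0
    rw [LinearMap.toMatrix'_mulVec]
    simpa [sub_eq_iff_eq_add] using hx

/-- The derivative of a function of `ℝ × E` that factors through the second projection. -/
theorem fderiv_comp_snd_apply {E F : Type*} [NormedAddCommGroup E] [NormedSpace ℝ E]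
    [NormedAddCommGroup F] [NormedSpace ℝ F] {g : E → F} (hg : Differentiable ℝ g)
    (p q : ℝ × E) : fderiv ℝ (fun r : ℝ × E => g r.2) p q = fderiv ℝ g p.2 q.2 := by
  have := (hg p.2).hasFDerivAt.comp p hasFDerivAt_snd
  exact DFunLike.congr_fun this.fderiv q

/-- The carrollian Killing vector fields of the flat carrollian spacetime
`C = ℝ^{1+D}` (with carrollian vector field `κ = ∂_t` and degenerate spatial metric
`b = Σ (dx^a)²`) are exactly `ξ = T(x) ∂_t + ξ_X` with `X` in the euclidean algebra:
for `D ≥ 2` and smooth `ξ⁰, ξ`, the carrollian Killing equations `∂ξ⁰/∂t = 0`,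
`∂ξ^a/∂t = 0` and `∂ξ^a/∂x^b + ∂ξ^b/∂x^a = 0` hold if and only if there are a smooth
`T : ℝ^D → ℝ`, a vector `v ∈ ℝ^D` and a skew-symmetric matrix `Λ` with
`ξ⁰(t,x) = T(x)` and `ξ^a(t,x) = v^a + Σ_b Λ^a_b x^b`. -/
theorem carrollian_killing_fields (D : ℕ) (hD : 2 ≤ D)
    (ξ0 : ℝ × (Fin D → ℝ) → ℝ) (ξ : ℝ × (Fin D → ℝ) → (Fin D → ℝ))
    (hξ0 : ContDiff ℝ (⊤ : ℕ∞) ξ0) (hξ : ContDiff ℝ (⊤ : ℕ∞) ξ) :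
    ((∀ p : ℝ × (Fin D → ℝ), fderiv ℝ ξ0 p ((1 : ℝ), (0 : Fin D → ℝ)) = 0) ∧
      (∀ (p : ℝ × (Fin D → ℝ)) (a : Fin D),
        fderiv ℝ ξ p ((1 : ℝ), (0 : Fin D → ℝ)) a = 0) ∧
      (∀ (p : ℝ × (Fin D → ℝ)) (a b : Fin D),
        fderiv ℝ ξ p ((0 : ℝ), Pi.single b 1) a
          + fderiv ℝ ξ p ((0 : ℝ), Pi.single a 1) b = 0))
    ↔ ∃ T : (Fin D → ℝ) → ℝ, ContDiff ℝ (⊤ : ℕ∞) T ∧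
        ∃ (v : Fin D → ℝ) (Λ : Matrix (Fin D) (Fin D) ℝ), Λᵀ = -Λ ∧
          ∀ (t : ℝ) (x : Fin D → ℝ),
            ξ0 (t, x) = T x ∧ ∀ a : Fin D, ξ (t, x) a = v a + ∑ b, Λ a b * x b := by
  constructor
  · rintro ⟨hT, ht, hK⟩
    have hslice : ContDiff ℝ (⊤ : ℕ∞) (fun x : Fin D → ℝ => ((0 : ℝ), x)) := by fun_prop
    have hfac : ξ = fun p => ξ (0, p.2) := funext fun p =>
      eq_of_fderiv_fst_eq_zero (hξ.differentiable (by simp)) (fun p => funext (ht p)) p.1 0 p.2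
    have hg : ContDiff ℝ (⊤ : ℕ∞) (fun x => ξ (0, x)) := hξ.comp hslice
    have hder (x u : Fin D → ℝ) : fderiv ℝ ξ (0, x) (0, u) = fderiv ℝ (fun y => ξ (0, y)) x u := by
      conv_lhs => rw [hfac]
      exact fderiv_comp_snd_apply (hg.differentiable (by simp)) _ _
    obtain ⟨v, Λ, hΛ, hv⟩ := exists_eq_add_mulVec_of_skew
      (hg.of_le (WithTop.coe_le_coe.2 le_top)) (fun x a b => by
        rw [← hder, ← hder]
        exact hK (0, x) a b)
    refine ⟨fun x => ξ0 (0, x), hξ0.comp hslice, v, Λ, hΛ, fun t x =>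
      ⟨eq_of_fderiv_fst_eq_zero (hξ0.differentiable (by simp)) hT t 0 x, fun a => ?_⟩⟩
    rw [hfac]
    exact congrFun (hv x) a
  · rintro ⟨T, hT, v, Λ, hΛ, h⟩
    have h0 : ξ0 = fun p => T p.2 := funext fun p => (h p.1 p.2).1
    let L : (Fin D → ℝ) →L[ℝ] (Fin D → ℝ) := LinearMap.toContinuousLinearMap Λ.mulVecLin
    have hL (x : Fin D → ℝ) : HasFDerivAt (fun y => v + L y) L x := L.hasFDerivAt.const_add v
    have h1 : ξ = fun p => v + L p.2 := funext fun p => funext fun a => (h p.1 p.2).2 a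
    have hder (p q : ℝ × (Fin D → ℝ)) : fderiv ℝ ξ p q = Λ *ᵥ q.2 := by
      rw [h1, fderiv_comp_snd_apply (fun x => (hL x).differentiableAt), (hL _).fderiv]
      rfl
    refine ⟨fun p => ?_, fun p a => ?_, fun p a b => ?_⟩
    · rw [h0, fderiv_comp_snd_apply (hT.differentiable (by simp))]
      simp
    · simp [hder]
    · have hab : Λ b a = -Λ a b := congrFun (congrFun hΛ a) b
      simp [hder, hab]
end

section
/- Let D ≥ 1, let N be a positive integer, and let ξ⁰ : ℝ × ℝ^D → ℝ and ξ = (ξ¹,…,ξ^D) : ℝ × ℝ^D → ℝ^D be smooth. Then there exists a smooth function λ : ℝ × ℝ^D → ℝ such that ∂ξ^a/∂t = 0 for all a, λ = N ∂ξ⁰/∂t, and ∂ξ^a/∂x^b + ∂ξ^b/∂x^a = λ δ_{ab} for all a,b (the level-N conformal carrollian Killing equations of the flat carrollian structure) if and only if there exist a smooth function T : ℝ^D → ℝ and a smooth conformal Killing vector field ζ of euclidean ℝ^D (i.e. ∂ζ^a/∂x^b + ∂ζ^b/∂x^a = (2/D)(div ζ) δ_{ab} with div ζ = Σ_a ∂ζ^a/∂x^a)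 such that ξ^a(t,x) = ζ^a(x) and ξ⁰(t,x) = T(x) + (2t/(N D)) (div ζ)(x). -/
section Slices

variable {E F : Type*} [NormedAddCommGroup E] [NormedSpace ℝ E]
  [NormedAddCommGroup F] [NormedSpace ℝ F]

theorem hasDerivAt_slice_fst {f : ℝ × E → F} (hf : Differentiable ℝ f) (t : ℝ) (x : E) :
    HasDerivAt (fun s => f (s, x)) (fderiv ℝ f (t, x) (1, 0)) t :=
  (hf (t, x)).hasFDerivAt.comp_hasDerivAt t ((hasDerivAt_id t).prodMk (hasDerivAt_const t x))

theorem fderiv_slice_snd {f : ℝ × E → F} (hf : Differentiable ℝ f) (t : ℝ) (x v : E) :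
    fderiv ℝ (fun y => f (t, y)) x v = fderiv ℝ f (t, x) (0, v) := by
  have h : HasFDerivAt (fun y => f (t, y)) _ x :=
    (hf (t, x)).hasFDerivAt.comp x (hasFDerivAt_prodMk_right t x)
  rw [h.fderiv]
  simp

/-- A function whose derivative in the first variable depends only on the second variable
is affine in the first variable. -/
theorem eq_add_smul_of_fderiv_fst_eq {f : ℝ × E → F} (hf : Differentiable ℝ f) {g : E → F}
    (h : ∀ t x, fderiv ℝ f (t, x) (1, 0) = g x) (t : ℝ) (x : E) :
    f (t, x) = f (0, x) + t • g x := by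
  have hd : ∀ s, HasDerivAt (fun s => f (s, x) - s • g x) 0 s := fun s => by
    simpa [h] using (hasDerivAt_slice_fst hf s x).fun_sub ((hasDerivAt_id s).smul_const (g x))
  have := is_const_of_deriv_eq_zero (fun s => (hd s).differentiableAt)
    (fun s => (hd s).deriv) t 0
  simpa [sub_eq_iff_eq_add] using this

end Slices


/-- Conformal carrollian Killing vector fields of the flat carrollian structure on
`ℝ^{1+D}` at level `N`: for `D ≥ 1`, `N > 0` and smooth `ξ⁰, ξ`, there is a smooth `λ`
with `∂ξ^a/∂t = 0`, `λ = N ∂ξ⁰/∂t` and `∂ξ^a/∂x^b + ∂ξ^b/∂x^a = λ δ_{ab}` if and only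
if there are a smooth `T : ℝ^D → ℝ` and a smooth conformal Killing vector field `ζ` of
euclidean `ℝ^D` such that `ξ^a(t,x) = ζ^a(x)` and
`ξ⁰(t,x) = T(x) + (2t/(N D)) (div ζ)(x)`. -/
theorem conformal_carrollian_killing_fields (D : ℕ) (hD : 1 ≤ D) (N : ℕ) (hN : 0 < N)
    (ξ0 : ℝ × (Fin D → ℝ) → ℝ) (ξ : ℝ × (Fin D → ℝ) → (Fin D → ℝ))
    (hξ0 : ContDiff ℝ (⊤ : ℕ∞) ξ0) (hξ : ContDiff ℝ (⊤ : ℕ∞) ξ) :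
    (∃ lam : ℝ × (Fin D → ℝ) → ℝ, ContDiff ℝ (⊤ : ℕ∞) lam ∧
      (∀ (p : ℝ × (Fin D → ℝ)) (a : Fin D),
        fderiv ℝ ξ p ((1 : ℝ), (0 : Fin D → ℝ)) a = 0) ∧
      (∀ p : ℝ × (Fin D → ℝ),
        lam p = (N : ℝ) * fderiv ℝ ξ0 p ((1 : ℝ), (0 : Fin D → ℝ))) ∧
      (∀ (p : ℝ × (Fin D → ℝ)) (a b : Fin D),
        fderiv ℝ ξ p ((0 : ℝ), Pi.single b 1) a
            + fderiv ℝ ξ p ((0 : ℝ), Pi.single a 1) b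
          = lam p * (if a = b then 1 else 0)))
    ↔ ∃ (T : (Fin D → ℝ) → ℝ) (ζ : (Fin D → ℝ) → (Fin D → ℝ)),
        ContDiff ℝ (⊤ : ℕ∞) T ∧ ContDiff ℝ (⊤ : ℕ∞) ζ ∧
        (∀ (x : Fin D → ℝ) (a b : Fin D),
          fderiv ℝ ζ x (Pi.single b 1) a + fderiv ℝ ζ x (Pi.single a 1) b
            = (2 / (D : ℝ)) * (∑ c, fderiv ℝ ζ x (Pi.single c 1) c)
                * (if a = b then 1 else 0)) ∧
        ∀ (t : ℝ) (x : Fin D → ℝ),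
          (∀ a : Fin D, ξ (t, x) a = ζ x a) ∧
          ξ0 (t, x) = T x
            + (2 * t / ((N : ℝ) * (D : ℝ))) * ∑ c, fderiv ℝ ζ x (Pi.single c 1) c := by
  have hDR : (D : ℝ) ≠ 0 := by positivity
  have hNR : (N : ℝ) ≠ 0 := by positivity
  have dξ0 : Differentiable ℝ ξ0 := hξ0.differentiable (by simp)
  have dξ : Differentiable ℝ ξ := hξ.differentiable (by simp)
  constructor
  · rintro ⟨lam, -, hstat, hlam, hkill⟩
    have hξt (t : ℝ) (x : Fin D → ℝ) : ξ (t, x) = ξ (0, x) := by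
      simpa using eq_add_smul_of_fderiv_fst_eq dξ (g := fun _ => 0)
        (fun t x => funext (hstat (t, x))) t x
    have hfd (t : ℝ) (x v : Fin D → ℝ) :
        fderiv ℝ ξ (t, x) (0, v) = fderiv ℝ (fun y => ξ (0, y)) x v := by
      rw [← fderiv_slice_snd dξ]
      simp only [hξt t]
    have hdiv (t : ℝ) (x : Fin D → ℝ) :
        lam (t, x) = 2 / D * ∑ c, fderiv ℝ (fun y => ξ (0, y)) x (Pi.single c 1) c := by
      have hc (c : Fin D) :
          fderiv ℝ (fun y => ξ (0, y)) x (Pi.single c 1) c = lam (t, x) / 2 := by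
        have := hkill (t, x) c c
        rw [hfd, if_pos rfl] at this
        linarith
      simp only [hc, Finset.sum_const, Finset.card_univ, Fintype.card_fin, nsmul_eq_mul]
      field_simp
    have hinc : ContDiff ℝ (⊤ : ℕ∞) (fun y : Fin D → ℝ => ((0 : ℝ), y)) :=
      contDiff_const.prodMk contDiff_id
    refine ⟨fun x => ξ0 (0, x), fun x => ξ (0, x), hξ0.comp hinc, hξ.comp hinc, ?_, ?_⟩
    · intro x a b
      rw [← hdiv 0 x, ← hkill (0, x) a b, hfd, hfd]
    · refine fun t x => ⟨fun a => congrFun (hξt t x) a, ?_⟩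
      have hξ0t (t : ℝ) (x : Fin D → ℝ) : fderiv ℝ ξ0 (t, x) (1, 0) =
          2 / (N * D) * ∑ c, fderiv ℝ (fun y => ξ (0, y)) x (Pi.single c 1) c := by
        have := (hlam (t, x)).symm.trans (hdiv t x)
        field_simp at this ⊢
        linarith
      rw [eq_add_smul_of_fderiv_fst_eq dξ0 hξ0t t x, smul_eq_mul]
      ring
  · rintro ⟨T, ζ, -, hζ, hkill, hform⟩
    obtain rfl : ξ = fun p => ζ p.2 := funext fun p => funext (hform p.1 p.2).1
    have hfd (p v : ℝ × (Fin D → ℝ)) :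
        fderiv ℝ (fun p : ℝ × (Fin D → ℝ) => ζ p.2) p v = fderiv ℝ ζ p.2 v.2 := by
      have h : HasFDerivAt (fun p : ℝ × (Fin D → ℝ) => ζ p.2) _ p :=
        (hζ.differentiable (by simp) p.2).hasFDerivAt.comp p hasFDerivAt_snd
      rw [h.fderiv]
      simp
    refine ⟨fun p => 2 / D * ∑ c, fderiv ℝ ζ p.2 (Pi.single c 1) c, ?_, ?_, ?_, ?_⟩
    · refine contDiff_const.mul (ContDiff.sum fun c _ => ?_)
      have h : ContDiff ℝ (⊤ : ℕ∞) fun x => fderiv ℝ ζ x (Pi.single c 1) :=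
        (hζ.fderiv_right (by simp)).clm_apply contDiff_const
      exact (contDiff_pi.1 h c).comp contDiff_snd
    · intro p a
      simp [hfd]
    · rintro ⟨t, x⟩
      have h := hasDerivAt_slice_fst dξ0 t x
      simp only [(hform _ x).2] at h
      have h' := (((((hasDerivAt_id t).const_mul 2).div_const ((N : ℝ) * D)).mul_const
        (∑ c, fderiv ℝ ζ x (Pi.single c 1) c)).const_add (T x))
      rw [h.unique h']
      field_simp
    · intro p a b
      rw [hfd, hfd]
      exact hkill p.2 a b
end

section
/- Let D ≥ 1 and let ξ⁰ : ℝ × ℝ^D → ℝ and ξ = (ξ¹,…,ξ^D) : ℝ × ℝ^D → ℝ^D be smooth. Then ξ⁰, ξ satisfy the galilean Killing equations of the flat galilean structure, namely ∂ξ⁰/∂t = 0, ∂ξ⁰/∂x^a = 0 for all a, and ∂ξ^a/∂x^b + ∂ξ^b/∂x^a = 0 for all a,b (at every (t,x)), if and only if ξ⁰ is a constant and there exist smooth functions f : ℝ → ℝ^D and Λ : ℝ → {skew-symmetric real D×D matrices} such that ξ^a(t,x) = f^a(t) + Σ_b Λ(t)^a_b x^b for all (t,x). (This identifies the Lie algebra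 of galilean Killing vector fields — the Coriolis algebra — as ℝ ⋉ C^∞(ℝ, 𝔢(D)).) -/
/-- The space derivative of `u` on `ℝ × E` is the derivative of its restriction to a time slice. -/
theorem fderiv_comp_prodMk_right {E F : Type*} [NormedAddCommGroup E] [NormedSpace ℝ E]
    [NormedAddCommGroup F] [NormedSpace ℝ F] {u : ℝ × E → F} {t : ℝ} {x : E}
    (hu : DifferentiableAt ℝ u (t, x)) (w : E) :
    fderiv ℝ (fun y => u (t, y)) x w = fderiv ℝ u (t, x) (0, w) := by
  have h := hu.hasFDerivAt.comp x (hasFDerivAt_prodMk_right t x)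
  exact congrArg (fun L => L w) h.fderiv

/-- Expansion of a continuous linear map on `ℝ^ι` in the standard basis. -/
theorem ContinuousLinearMap.apply_eq_sum_single {ι F : Type*} [Fintype ι] [DecidableEq ι]
    [NormedAddCommGroup F] [NormedSpace ℝ F] (L : (ι → ℝ) →L[ℝ] F) (x : ι → ℝ) :
    L x = ∑ i, x i • L (Pi.single i 1) := by
  conv_lhs => rw [pi_eq_sum_univ' x]
  simp only [map_sum, map_smul]

/-- A continuous linear map on `ℝ^ι` that kills the standard basis is zero. -/
theorem ContinuousLinearMap.eq_zero_of_pi_single {ι F : Type*} [Fintype ι] [DecidableEq ι]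
    [NormedAddCommGroup F] [NormedSpace ℝ F] {L : (ι → ℝ) →L[ℝ] F}
    (h : ∀ i, L (Pi.single i 1) = 0) : L = 0 := by
  ext x
  simp [L.apply_eq_sum_single x, h]

/-- A three-index family symmetric in the first two indices and antisymmetric in the last two
vanishes. -/
theorem eq_zero_of_symm_of_antisymm {ι : Type*} {S : ι → ι → ι → ℝ}
    (hsymm : ∀ a b c, S a b c = S b a c) (hanti : ∀ a b c, S a b c = -S a c b) (a b c : ι) :
    S a b c = 0 := by
  linarith [hsymm a b c, hanti b a c, hsymm b c a, hanti c b a, hsymm c a b, hanti a c b]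

/-- A Killing vector field of Euclidean space has vanishing second derivative. -/
theorem fderiv_fderiv_eq_zero_of_killing {ι : Type*} [Fintype ι] [DecidableEq ι]
    {v : (ι → ℝ) → (ι → ℝ)} (hv : ContDiff ℝ 2 v)
    (hK : ∀ x a b, fderiv ℝ v x (Pi.single b 1) a + fderiv ℝ v x (Pi.single a 1) b = 0)
    (x : ι → ℝ) : fderiv ℝ (fderiv ℝ v) x = 0 := by
  have hd : DifferentiableAt ℝ (fderiv ℝ v) x :=
    ((hv.fderiv_right (m := 1) (by norm_num)).differentiable one_ne_zero) x
  have hcomp (a b : ι) : HasFDerivAt (fun y => fderiv ℝ v y (Pi.single b 1) a)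
      ((ContinuousLinearMap.proj a).comp
        ((fderiv ℝ (fderiv ℝ v) x).flip (Pi.single b 1))) x := by
    have h := hd.hasFDerivAt.clm_apply (hasFDerivAt_const (Pi.single b (1 : ℝ)) x)
    simpa using hasFDerivAt_pi'.1 h a
  have hanti (w : ι → ℝ) (b a : ι) : fderiv ℝ (fderiv ℝ v) x w (Pi.single b 1) a
      = -fderiv ℝ (fderiv ℝ v) x w (Pi.single a 1) b := by
    have h := (hcomp a b).add (hcomp b a)
    have h0 : (fun y => fderiv ℝ v y (Pi.single b 1) a) +
        (fun y => fderiv ℝ v y (Pi.single a 1) b) = fun _ => (0 : ℝ) := funext fun y => hK y a b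
    rw [h0] at h
    have := congrArg (fun L => L w) (h.unique (hasFDerivAt_const (0 : ℝ) x))
    simp at this
    linarith
  have hsymm : IsSymmSndFDerivAt ℝ v x := hv.contDiffAt.isSymmSndFDerivAt (by simp)
  refine ContinuousLinearMap.eq_zero_of_pi_single fun a =>
    ContinuousLinearMap.eq_zero_of_pi_single fun b => funext fun c => ?_
  exact eq_zero_of_symm_of_antisymm
    (S := fun a b c => fderiv ℝ (fderiv ℝ v) x (Pi.single a 1) (Pi.single b 1) c)
    (fun a b c => congrFun (hsymm.eq _ _) c) (fun a b c => hanti _ b c) a b c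

/-- A Killing vector field of Euclidean space is affine. -/
theorem eq_add_fderiv_of_killing {ι : Type*} [Fintype ι] [DecidableEq ι]
    {v : (ι → ℝ) → (ι → ℝ)} (hv : ContDiff ℝ 2 v)
    (hK : ∀ x a b, fderiv ℝ v x (Pi.single b 1) a + fderiv ℝ v x (Pi.single a 1) b = 0)
    (x : ι → ℝ) : v x = v 0 + fderiv ℝ v 0 x := by
  have hconst (y : ι → ℝ) : fderiv ℝ v y = fderiv ℝ v 0 :=
    is_const_of_fderiv_eq_zero
      ((hv.fderiv_right (m := 1) (by norm_num)).differentiable one_ne_zero)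
      (fderiv_fderiv_eq_zero_of_killing hv hK) y 0
  have hv1 : Differentiable ℝ v := hv.differentiable two_ne_zero
  have h := is_const_of_fderiv_eq_zero (f := fun y => v y - fderiv ℝ v 0 y)
    (hv1.sub (fderiv ℝ v 0).differentiable)
    (fun y => by
      rw [fderiv_fun_sub (hv1 y) (fderiv ℝ v 0).differentiableAt, ContinuousLinearMap.fderiv,
        hconst, sub_self]) x 0
  simp only [map_zero, sub_zero] at h
  exact sub_eq_iff_eq_add.1 h

/-- The derivative of an affine map in a coordinate direction is a column of its matrix. -/
theorem fderiv_single_of_affine {ι : Type*} [Fintype ι] [DecidableEq ι]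
    {v : (ι → ℝ) → (ι → ℝ)} {c : ι → ℝ} {M : ι → ι → ℝ}
    (hv : ∀ x a, v x a = c a + ∑ b, M a b * x b) (x : ι → ℝ) (a b : ι) :
    fderiv ℝ v x (Pi.single b 1) a = M a b := by
  have h : v = fun x => c + (Matrix.mulVecLin (Matrix.of M)).toContinuousLinearMap x := by
    ext x a
    simp [hv, Matrix.mulVec, dotProduct]
  rw [h, fderiv_const_add, ContinuousLinearMap.fderiv]
  simp


/-- The galilean Killing vector fields (the Coriolis algebra) of the flat galilean
structure `τ = dt`, `h = Σ ∂_a ⊗ ∂_a` on `ℝ^{1+D}`: for `D ≥ 1` and smooth `ξ⁰, ξ`,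
the galilean Killing equations `∂ξ⁰/∂t = 0`, `∂ξ⁰/∂x^a = 0` and
`∂ξ^a/∂x^b + ∂ξ^b/∂x^a = 0` hold if and only if `ξ⁰` is a constant and there exist
smooth `f : ℝ → ℝ^D` and a smooth family `Λ` of skew-symmetric `D × D` matrices with
`ξ^a(t,x) = f^a(t) + Σ_b Λ(t)^a_b x^b`;  this realises the Coriolis algebra as
`ℝ ⋉ C^∞(ℝ, 𝔢(D))`. -/
theorem galilean_killing_fields (D : ℕ) (hD : 1 ≤ D)
    (ξ0 : ℝ × (Fin D → ℝ) → ℝ) (ξ : ℝ × (Fin D → ℝ) → (Fin D → ℝ))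
    (hξ0 : ContDiff ℝ (⊤ : ℕ∞) ξ0) (hξ : ContDiff ℝ (⊤ : ℕ∞) ξ) :
    ((∀ p : ℝ × (Fin D → ℝ), fderiv ℝ ξ0 p ((1 : ℝ), (0 : Fin D → ℝ)) = 0) ∧
      (∀ (p : ℝ × (Fin D → ℝ)) (a : Fin D),
        fderiv ℝ ξ0 p ((0 : ℝ), Pi.single a 1) = 0) ∧
      (∀ (p : ℝ × (Fin D → ℝ)) (a b : Fin D),
        fderiv ℝ ξ p ((0 : ℝ), Pi.single b 1) a
          + fderiv ℝ ξ p ((0 : ℝ), Pi.single a 1) b = 0))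
    ↔ ((∃ c : ℝ, ∀ p : ℝ × (Fin D → ℝ), ξ0 p = c) ∧
        ∃ (f : ℝ → (Fin D → ℝ)) (Λ : ℝ → Fin D → Fin D → ℝ),
          ContDiff ℝ (⊤ : ℕ∞) f ∧ ContDiff ℝ (⊤ : ℕ∞) Λ ∧
          (∀ (t : ℝ) (a b : Fin D), Λ t a b = -Λ t b a) ∧
          ∀ (t : ℝ) (x : Fin D → ℝ) (a : Fin D),
            ξ (t, x) a = f t a + ∑ b, Λ t a b * x b) := by
  have hdiff : Differentiable ℝ ξ := hξ.differentiable (by simp)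
  constructor
  · rintro ⟨ht, hx, hK⟩
    refine ⟨⟨ξ0 0, fun p => is_const_of_fderiv_eq_zero (hξ0.differentiable (by simp))
      (fun p => ?_) p 0⟩, fun t => ξ (t, 0), fun t a b => fderiv ℝ ξ (t, 0) (0, Pi.single b 1) a,
      by fun_prop, ?_, fun t a b => eq_neg_of_add_eq_zero_left (hK (t, 0) a b), fun t x a => ?_⟩
    · refine ContinuousLinearMap.prod_ext (ContinuousLinearMap.ext_ring ?_)
        (ContinuousLinearMap.eq_zero_of_pi_single fun a => ?_)
      · simpa using ht p
      · simpa using hx p a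
    · have hd : ContDiff ℝ (⊤ : ℕ∞) (fderiv ℝ ξ) := hξ.fderiv_right (by simp)
      refine contDiff_pi.2 fun a => contDiff_pi.2 fun b => ?_
      have h : ContDiff ℝ (⊤ : ℕ∞)
          (fun t : ℝ => fderiv ℝ ξ (t, 0) ((0 : ℝ), (Pi.single b 1 : Fin D → ℝ))) :=
        (hd.comp (contDiff_id.prodMk contDiff_const)).clm_apply contDiff_const
      exact contDiff_pi.1 h a
    · have hslice : ContDiff ℝ 2 (fun y => ξ (t, y)) :=
        (hξ.comp (contDiff_const.prodMk contDiff_id)).of_le (WithTop.coe_le_coe.2 le_top)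
      have h := congrFun (eq_add_fderiv_of_killing hslice (fun y a b => by
        simpa only [fderiv_comp_prodMk_right (hdiff _)] using hK (t, y) a b) x) a
      rw [h, Pi.add_apply, ContinuousLinearMap.apply_eq_sum_single _ x]
      simp [fderiv_comp_prodMk_right (hdiff _), mul_comm]
  · rintro ⟨⟨c, hc⟩, f, Λ, -, -, hskew, hform⟩
    obtain rfl : ξ0 = fun _ => c := funext hc
    refine ⟨by simp, by simp, fun ⟨t, x⟩ a b => ?_⟩
    rw [← fderiv_comp_prodMk_right (hdiff _), ← fderiv_comp_prodMk_right (hdiff _),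
      fderiv_single_of_affine (hform t), fderiv_single_of_affine (hform t), hskew t a b,
      neg_add_cancel]
end

section
/- Let D ≥ 1, let N be a positive integer, and let ξ⁰ : ℝ × ℝ^D → ℝ and ξ = (ξ¹,…,ξ^D) : ℝ × ℝ^D → ℝ^D be smooth. Then there exists a smooth function λ such that ∂ξ⁰/∂x^a = 0 for all a, ∂ξ⁰/∂t = −λ/N, and ∂ξ^a/∂x^b + ∂ξ^b/∂x^a = −λ δ_{ab} for all a,b (the level-N conformal galilean Killing equations of the flat galilean structure) if and only if ξ⁰ depends only on t and there exist smooth functions f : ℝ → ℝ^D and Λ : ℝ → {skew-symmetric real D×D matrices} such that ξ^a(t,x) = f^a(t) + Σ_b Λ(t)^a_b x^b + φ(t) x^a, where φ(t) = (N/2)·dξ⁰/dt. In particular, every level-N conformal galilean Killing vector field is determined by an arbitrary time-dependent euclidean motion (f,Λ) together with one scalar function of time governing simultaneously the time component and the spatial homothety. -/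
/-- A matrix-skew linear endomorphism is orthogonal to the identity. -/
lemma dotProduct_self_eq_zero_of_skew {ι : Type*} [Fintype ι] [DecidableEq ι]
    (L : (ι → ℝ) →ₗ[ℝ] (ι → ℝ))
    (hL : ∀ a b, L (Pi.single b 1) a + L (Pi.single a 1) b = 0) (v : ι → ℝ) :
    L v ⬝ᵥ v = 0 := by
  have hv : ∀ a, L v a = ∑ b, v b * L (Pi.single b 1) a := fun a => by
    conv_lhs => rw [pi_eq_sum_univ' v]
    simp [Finset.sum_apply]
  have h₁ : L v ⬝ᵥ v = ∑ a, ∑ b, v b * L (Pi.single b 1) a * v a := by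
    simp only [dotProduct, hv, Finset.sum_mul]
  have h₂ : L v ⬝ᵥ v = ∑ a, ∑ b, v a * L (Pi.single a 1) b * v b := by
    rw [h₁, Finset.sum_comm]
  have h₃ : L v ⬝ᵥ v + L v ⬝ᵥ v = 0 := by
    conv_lhs => rw [h₁]; arg 2; rw [← h₁, h₂]
    simp only [← Finset.sum_add_distrib]
    refine Finset.sum_eq_zero fun a _ => Finset.sum_eq_zero fun b _ => ?_
    linear_combination v a * v b * hL a b
  linarith

/-- The increments of a euclidean Killing field are orthogonal to the displacement. -/
lemma killing_sub_dotProduct_sub {ι : Type*} [Fintype ι] [DecidableEq ι]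
    (g : (ι → ℝ) → (ι → ℝ)) (hg : Differentiable ℝ g)
    (hskew : ∀ x a b, fderiv ℝ g x (Pi.single b 1) a + fderiv ℝ g x (Pi.single a 1) b = 0)
    (x y : ι → ℝ) : (g y - g x) ⬝ᵥ (y - x) = 0 := by
  have hd : ∀ s : ℝ, HasDerivAt (fun s : ℝ => g (x + s • (y - x)) ⬝ᵥ (y - x)) 0 s := by
    intro s
    have hline : HasDerivAt (fun s : ℝ => x + s • (y - x)) (y - x) s := by
      simpa using ((hasDerivAt_id s).smul_const (y - x)).const_add x
    have hcomp := (hg (x + s • (y - x))).hasFDerivAt.comp_hasDerivAt s hline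
    rw [← dotProduct_self_eq_zero_of_skew (fderiv ℝ g (x + s • (y - x))).toLinearMap
      (hskew _) (y - x)]
    simp only [dotProduct]
    exact HasDerivAt.fun_sum fun a _ => (hasDerivAt_pi.1 hcomp a).mul_const _
  have hconst := is_const_of_deriv_eq_zero (fun s => (hd s).differentiableAt)
    (fun s => (hd s).deriv) 1 0
  rw [sub_dotProduct, sub_eq_zero]
  simpa only [one_smul, zero_smul, add_zero, add_sub_cancel] using hconst

/-- A euclidean Killing field is an infinitesimal rigid motion. -/
lemma killing_eq_rigid_motion {ι : Type*} [Fintype ι] [DecidableEq ι]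
    (g : (ι → ℝ) → (ι → ℝ)) (hg : Differentiable ℝ g)
    (hskew : ∀ x a b, fderiv ℝ g x (Pi.single b 1) a + fderiv ℝ g x (Pi.single a 1) b = 0) :
    (∀ a b, g (Pi.single b 1) a - g 0 a = -(g (Pi.single a 1) b - g 0 b)) ∧
      ∀ x a, g x a = g 0 a + ∑ b, (g (Pi.single b 1) a - g 0 a) * x b := by
  have hpolar : ∀ x y, (g x - g 0) ⬝ᵥ y = -((g y - g 0) ⬝ᵥ x) := by
    intro x y
    have hx := killing_sub_dotProduct_sub g hg hskew 0 x
    have hy := killing_sub_dotProduct_sub g hg hskew 0 y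
    have hxy := killing_sub_dotProduct_sub g hg hskew x y
    simp only [sub_dotProduct, dotProduct_sub, dotProduct_zero] at *
    linarith
  have hanti : ∀ a b, g (Pi.single b 1) a - g 0 a = -(g (Pi.single a 1) b - g 0 b) :=
    fun a b => by simpa using hpolar (Pi.single b 1) (Pi.single a 1)
  refine ⟨hanti, fun x a => ?_⟩
  have h := hpolar x (Pi.single a 1)
  simp only [dotProduct_single, mul_one, Pi.sub_apply] at h
  rw [← sub_eq_iff_eq_add', h, dotProduct, ← Finset.sum_neg_distrib]
  refine Finset.sum_congr rfl fun b _ => ?_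
  rw [hanti a b, Pi.sub_apply, neg_mul]

/-- For a function independent of the spatial variables, so is its time derivative. -/
lemma fderiv_time_eq_of_indep {E : Type*} [NormedAddCommGroup E] [NormedSpace ℝ E]
    {u : ℝ × E → ℝ} (hu : Differentiable ℝ u) (hind : ∀ t x x', u (t, x) = u (t, x'))
    (t : ℝ) (x x' : E) : fderiv ℝ u (t, x) (1, 0) = fderiv ℝ u (t, x') (1, 0) := by
  rw [← (hu _).lineDeriv_eq_fderiv, ← (hu _).lineDeriv_eq_fderiv, lineDeriv, lineDeriv]
  congr 1
  ext s
  simpa using hind _ _ _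

/-- A function whose spatial derivatives vanish depends only on time. -/
lemma indep_of_fderiv_space_eq_zero {ι : Type*} [Fintype ι] [DecidableEq ι]
    {u : ℝ × (ι → ℝ) → ℝ} (hu : Differentiable ℝ u)
    (h : ∀ p a, fderiv ℝ u p (0, Pi.single a 1) = 0) (t : ℝ) (x x' : ι → ℝ) :
    u (t, x) = u (t, x') := by
  have hd : ∀ y, HasFDerivAt (fun y => u (t, y)) (0 : (ι → ℝ) →L[ℝ] ℝ) y := by
    intro y
    have hc := (hu (t, y)).hasFDerivAt.comp y (hasFDerivAt_prodMk_right (𝕜 := ℝ) t y)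
    have hz : (fderiv ℝ u (t, y)).comp (ContinuousLinearMap.inr ℝ ℝ (ι → ℝ)) = 0 := by
      apply ContinuousLinearMap.coe_injective
      ext a
      simpa using h (t, y) a
    rwa [hz] at hc
  exact is_const_of_fderiv_eq_zero (𝕜 := ℝ) (fun y => (hd y).differentiableAt)
    (fun y => (hd y).fderiv) x x'

/-- Level-`N` conformal galilean Killing vector fields of the flat galilean structure
`τ = dt`, `h = Σ ∂_a ⊗ ∂_a` on `ℝ^{1+D}`: for `D ≥ 1`, `N > 0` and smooth `ξ⁰, ξ`,
there is a smooth `λ` with `∂ξ⁰/∂x^a = 0`, `∂ξ⁰/∂t = -λ/N` and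
`∂ξ^a/∂x^b + ∂ξ^b/∂x^a = -λ δ_{ab}` if and only if `ξ⁰` depends only on `t` and there
are smooth `f : ℝ → ℝ^D` and a smooth family `Λ` of skew-symmetric matrices such that
`ξ^a(t,x) = f^a(t) + Σ_b Λ(t)^a_b x^b + φ(t) x^a` with `φ(t) = (N/2)·dξ⁰/dt`. -/
theorem conformal_galilean_killing_fields (D : ℕ) (hD : 1 ≤ D) (N : ℕ) (hN : 0 < N)
    (ξ0 : ℝ × (Fin D → ℝ) → ℝ) (ξ : ℝ × (Fin D → ℝ) → (Fin D → ℝ))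
    (hξ0 : ContDiff ℝ (⊤ : ℕ∞) ξ0) (hξ : ContDiff ℝ (⊤ : ℕ∞) ξ) :
    (∃ lam : ℝ × (Fin D → ℝ) → ℝ, ContDiff ℝ (⊤ : ℕ∞) lam ∧
      (∀ (p : ℝ × (Fin D → ℝ)) (a : Fin D),
        fderiv ℝ ξ0 p ((0 : ℝ), Pi.single a 1) = 0) ∧
      (∀ p : ℝ × (Fin D → ℝ),
        fderiv ℝ ξ0 p ((1 : ℝ), (0 : Fin D → ℝ)) = -(lam p / (N : ℝ))) ∧
      (∀ (p : ℝ × (Fin D → ℝ)) (a b : Fin D),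
        fderiv ℝ ξ p ((0 : ℝ), Pi.single b 1) a
            + fderiv ℝ ξ p ((0 : ℝ), Pi.single a 1) b
          = -(lam p) * (if a = b then 1 else 0)))
    ↔ ((∀ (t : ℝ) (x x' : Fin D → ℝ), ξ0 (t, x) = ξ0 (t, x')) ∧
        ∃ (f : ℝ → (Fin D → ℝ)) (Λ : ℝ → Fin D → Fin D → ℝ),
          ContDiff ℝ (⊤ : ℕ∞) f ∧ ContDiff ℝ (⊤ : ℕ∞) Λ ∧
          (∀ (t : ℝ) (a b : Fin D), Λ t a b = -Λ t b a) ∧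
          ∀ (t : ℝ) (x : Fin D → ℝ) (a : Fin D),
            ξ (t, x) a = f t a + (∑ b, Λ t a b * x b)
              + (((N : ℝ) / 2)
                  * fderiv ℝ ξ0 (t, (0 : Fin D → ℝ)) ((1 : ℝ), (0 : Fin D → ℝ)))
                * x a) := by
  have hN0 : (N : ℝ) ≠ 0 := by exact_mod_cast hN.ne'
  have hd0 : Differentiable ℝ ξ0 := hξ0.differentiable (by simp)
  have hd : Differentiable ℝ ξ := hξ.differentiable (by simp)
  have hdt : ContDiff ℝ (⊤ : ℕ∞) fun p => fderiv ℝ ξ0 p ((1 : ℝ), (0 : Fin D → ℝ)) :=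
    (hξ0.fderiv_right (m := (⊤ : ℕ∞)) (by simp)).clm_apply contDiff_const
  constructor
  · rintro ⟨lam, -, hspace, htime, hkill⟩
    have hind := indep_of_fderiv_space_eq_zero hd0 hspace
    refine ⟨hind, ?_⟩
    set φ : ℝ → ℝ := fun t =>
      (N : ℝ) / 2 * fderiv ℝ ξ0 (t, (0 : Fin D → ℝ)) ((1 : ℝ), (0 : Fin D → ℝ)) with hφ
    have hφs : ContDiff ℝ (⊤ : ℕ∞) φ :=
      contDiff_const.mul (hdt.comp (contDiff_id.prodMk contDiff_const))
    have hlam : ∀ t x, -lam (t, x) = 2 * φ t := by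
      intro t x
      simp only [hφ]
      rw [fderiv_time_eq_of_indep hd0 hind t 0 x, htime]
      field_simp
    have hξt : ∀ x : Fin D → ℝ, ContDiff ℝ (⊤ : ℕ∞) fun t => ξ (t, x) := fun x =>
      hξ.comp (contDiff_id.prodMk contDiff_const)
    have hrigid : ∀ t : ℝ, _ := fun t =>
      killing_eq_rigid_motion (fun x => ξ (t, x) - φ t • x)
        (by fun_prop) (fun x a b => by
          have hx : HasFDerivAt (fun x => ξ (t, x) - φ t • x)
              ((fderiv ℝ ξ (t, x)).comp (ContinuousLinearMap.inr ℝ ℝ (Fin D → ℝ))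
                - φ t • ContinuousLinearMap.id ℝ (Fin D → ℝ)) x :=
            ((hd (t, x)).hasFDerivAt.comp x (hasFDerivAt_prodMk_right (𝕜 := ℝ) t x)).sub
              ((hasFDerivAt_id x).const_smul (φ t))
          have hk := hkill (t, x) a b
          rw [hlam] at hk
          rw [hx.fderiv]
          rcases eq_or_ne a b with rfl | hab
          · simp at hk ⊢
            linarith
          · simp [hab, hab.symm] at hk ⊢
            linarith)
    refine ⟨fun t => ξ (t, 0),
      fun t a b => (ξ (t, Pi.single b 1) - φ t • (Pi.single b 1 : Fin D → ℝ)) a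
        - (ξ (t, 0) - φ t • (0 : Fin D → ℝ)) a, hξt 0, ?_, fun t => (hrigid t).1,
      fun t x a => ?_⟩
    · refine contDiff_pi.2 fun a => contDiff_pi.2 fun b => ?_
      have h₁ := contDiff_pi.1 (hξt (Pi.single b 1)) a
      have h₂ := contDiff_pi.1 (hξt 0) a
      simp only [Pi.sub_apply, Pi.smul_apply, smul_eq_mul]
      exact (h₁.sub (hφs.mul contDiff_const)).sub (h₂.sub (hφs.mul contDiff_const))
    · have h := (hrigid t).2 x a
      simp only [Pi.sub_apply, Pi.smul_apply, smul_eq_mul, Pi.zero_apply, mul_zero,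
        sub_zero] at h ⊢
      change _ = _ + φ t * x a
      linarith
  · rintro ⟨hind, f, Λ, -, -, hskew, hform⟩
    refine ⟨fun p => -(N * fderiv ℝ ξ0 p ((1 : ℝ), (0 : Fin D → ℝ))),
      (contDiff_const.mul hdt).neg, ?_, ?_, ?_⟩
    · rintro ⟨t, x⟩ a
      rw [← (hd0 _).lineDeriv_eq_fderiv, lineDeriv]
      have hconst : (fun s : ℝ => ξ0 ((t, x) + s • ((0 : ℝ), Pi.single a (1 : ℝ))))
          = fun _ => ξ0 (t, x) := by
        ext s
        simpa using hind _ _ _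
      rw [hconst, deriv_const]
    · intro p
      field_simp
    · rintro ⟨t, x⟩ a b
      set c := fderiv ℝ ξ0 (t, (0 : Fin D → ℝ)) ((1 : ℝ), (0 : Fin D → ℝ)) with hc
      have hpart : ∀ a b : Fin D, fderiv ℝ ξ (t, x) ((0 : ℝ), Pi.single b 1) a
          = Λ t a b + (N : ℝ) / 2 * c * (if a = b then 1 else 0) := by
        intro a b
        have h₁ := hasDerivAt_pi.1 ((hd (t, x)).hasFDerivAt.hasLineDerivAt
          ((0 : ℝ), (Pi.single b 1 : Fin D → ℝ))) a
        have h₂ : HasDerivAt (fun s : ℝ => ξ (t, x) a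
            + s * (Λ t a b + (N : ℝ) / 2 * c * (if a = b then 1 else 0)))
            (Λ t a b + (N : ℝ) / 2 * c * (if a = b then 1 else 0)) 0 := by
          simpa using ((hasDerivAt_id (0 : ℝ)).mul_const
            (Λ t a b + (N : ℝ) / 2 * c * (if a = b then 1 else 0))).const_add (ξ (t, x) a)
        refine h₁.unique (h₂.congr_of_eventuallyEq (.of_forall fun s => ?_))
        simp only [Prod.mk_add_mk, Prod.smul_mk, add_zero, hform, ← hc,
          Pi.add_apply, Pi.smul_apply, smul_eq_mul, mul_add, Finset.sum_add_distrib,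
          Pi.single_apply, mul_ite, mul_one, mul_zero, Finset.sum_ite_eq',
          Finset.mem_univ, if_true]
        split_ifs <;> ring
      beta_reduce
      rw [hpart, hpart, hskew t b a, fderiv_time_eq_of_indep hd0 hind t x 0, ← hc]
      simp only [eq_comm (a := b)]
      ring
end

section
/- Consider the two-dimensional carrollian light cone LC, modelled on M = {(r,θ) : r > 0, θ ∈ ℝ} with carrollian vector field κ = r ∂/∂r and degenerate metric b = r² dθ². (i) A smooth vector field ξ = ξ^r ∂/∂r + ξ^θ ∂/∂θ on M satisfies the carrollian Killing equations r ∂ξ^r/∂r − ξ^r = 0, ∂ξ^θ/∂r = 0 and ξ^r + r ∂ξ^θ/∂θ = 0 if and only if there exists a smooth function f : ℝ → ℝ with ξ^θ(r,θ) = f(θ) and ξ^r(r,θ) = −r f'(θ). (ii) Writing ξ_f := f(θ) ∂/∂θ − f'(θ) r ∂/∂r, the Lie bracket of vector fields satisfies [ξ_f, ξ_g] = ξ_{f g' − f' g} for all smooth f,g : ℝ → ℝ; hence the Lie algebra of carrollian Killing vector fields of LC in D = 1 is isomorphic to C^∞(ℝ) with the wronskian bracket. -/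
theorem isOpen_fst_pos : IsOpen {p : ℝ × ℝ | 0 < p.1} :=
  isOpen_lt continuous_const continuous_fst

theorem hasDerivAt_fst_slice {F : ℝ × ℝ → ℝ} {p : ℝ × ℝ} (h : DifferentiableAt ℝ F p) :
    HasDerivAt (fun t => F (t, p.2)) (fderiv ℝ F p (1, 0)) p.1 :=
  HasFDerivAt.comp_hasDerivAt (f := fun t => (t, p.2)) p.1 h.hasFDerivAt
    ((hasDerivAt_id p.1).prodMk (hasDerivAt_const p.1 p.2))

theorem hasDerivAt_snd_slice {F : ℝ × ℝ → ℝ} {p : ℝ × ℝ} (h : DifferentiableAt ℝ F p) :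
    HasDerivAt (fun t => F (p.1, t)) (fderiv ℝ F p (0, 1)) p.2 :=
  HasFDerivAt.comp_hasDerivAt (f := fun t => (p.1, t)) p.2 h.hasFDerivAt
    ((hasDerivAt_const p.2 p.1).prodMk (hasDerivAt_id p.2))

/-- A function on the half plane with vanishing radial derivative is independent of `r`. -/
theorem eq_of_fderiv_fst_eq_zero_s16 {F : ℝ × ℝ → ℝ}
    (hd : ∀ p : ℝ × ℝ, 0 < p.1 → DifferentiableAt ℝ F p)
    (h : ∀ p : ℝ × ℝ, 0 < p.1 → fderiv ℝ F p (1, 0) = 0) {r s : ℝ} (hr : 0 < r) (hs : 0 < s)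
    (θ : ℝ) : F (r, θ) = F (s, θ) := by
  have key : ∀ t ∈ Set.Ioi (0 : ℝ), HasDerivAt (fun t => F (t, θ)) 0 t := fun t ht => by
    simpa only [h (t, θ) ht] using hasDerivAt_fst_slice (hd (t, θ) ht)
  exact isOpen_Ioi.is_const_of_deriv_eq_zero (convex_Ioi (0 : ℝ)).isPreconnected
    (fun t ht => (key t ht).differentiableAt.differentiableWithinAt)
    (fun t ht => (key t ht).deriv) hr hs

/-- The derivative of the vector field `ξ_f = f(θ) ∂_θ - f'(θ) r ∂_r`. -/
theorem fderiv_killingField_apply {f : ℝ → ℝ} (hf : ContDiff ℝ (⊤ : ℕ∞) f) (p v : ℝ × ℝ) :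
    fderiv ℝ (fun q : ℝ × ℝ => ((-deriv f q.2 * q.1, f q.2) : ℝ × ℝ)) p v
      = (-deriv (deriv f) p.2 * v.2 * p.1 - deriv f p.2 * v.1, deriv f p.2 * v.2) := by
  have h1 := (hf.differentiable (by simp) p.2).hasDerivAt
  have h2 := ((contDiff_infty_iff_deriv.1 hf).2.differentiable (by simp) p.2).hasDerivAt
  have hs : HasFDerivAt (fun q : ℝ × ℝ => q.2) (ContinuousLinearMap.snd ℝ ℝ ℝ) p := hasFDerivAt_snd
  have hr : HasFDerivAt (fun q : ℝ × ℝ => q.1) (ContinuousLinearMap.fst ℝ ℝ ℝ) p := hasFDerivAt_fst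
  have h3 := h1.comp_hasFDerivAt p hs
  have h4 := ((h2.comp_hasFDerivAt p hs).neg.mul hr).prodMk h3
  have h5 : HasFDerivAt (fun q : ℝ × ℝ => ((-deriv f q.2 * q.1, f q.2) : ℝ × ℝ)) _ p := h4
  rw [h5.fderiv]
  ext <;> simp
  ring


/-- The carrollian Killing vector fields of the two-dimensional carrollian light cone
`LC`, modelled on `M = {(r,θ) : r > 0}` with carrollian vector field `κ = r ∂_r` and
degenerate metric `b = r² dθ²`.
(i) A smooth vector field `ξ = ξ^r ∂_r + ξ^θ ∂_θ` satisfies the carrollian Killing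
equations `r ∂ξ^r/∂r - ξ^r = 0`, `∂ξ^θ/∂r = 0`, `ξ^r + r ∂ξ^θ/∂θ = 0` iff there is a
smooth `f : ℝ → ℝ` with `ξ^θ = f(θ)` and `ξ^r = -r f'(θ)`.
(ii) Writing `ξ_f = f(θ) ∂_θ - f'(θ) r ∂_r` (components `(-f'(θ) r, f(θ))` in `(r,θ)`),
the Lie bracket satisfies `[ξ_f, ξ_g] = ξ_{f g' - f' g}`: the Lie algebra of carrollian
Killing vector fields of `LC` in `D = 1` is `C^∞(ℝ)` with the wronskian bracket. -/
theorem lightcone_carrollian_killing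
    (ξr ξθ : ℝ × ℝ → ℝ)
    (hξr : ContDiffOn ℝ (⊤ : ℕ∞) ξr {p : ℝ × ℝ | 0 < p.1})
    (hξθ : ContDiffOn ℝ (⊤ : ℕ∞) ξθ {p : ℝ × ℝ | 0 < p.1}) :
    ((∀ p : ℝ × ℝ, 0 < p.1 →
        p.1 * fderiv ℝ ξr p ((1 : ℝ), (0 : ℝ)) - ξr p = 0 ∧
        fderiv ℝ ξθ p ((1 : ℝ), (0 : ℝ)) = 0 ∧
        ξr p + p.1 * fderiv ℝ ξθ p ((0 : ℝ), (1 : ℝ)) = 0)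
      ↔ ∃ f : ℝ → ℝ, ContDiff ℝ (⊤ : ℕ∞) f ∧
          ∀ p : ℝ × ℝ, 0 < p.1 → ξθ p = f p.2 ∧ ξr p = -p.1 * deriv f p.2) ∧
    (∀ f g : ℝ → ℝ, ContDiff ℝ (⊤ : ℕ∞) f → ContDiff ℝ (⊤ : ℕ∞) g → ∀ p : ℝ × ℝ,
        fderiv ℝ (fun q : ℝ × ℝ => ((-deriv g q.2 * q.1, g q.2) : ℝ × ℝ)) p
            ((-deriv f p.2 * p.1, f p.2) : ℝ × ℝ)
          - fderiv ℝ (fun q : ℝ × ℝ => ((-deriv f q.2 * q.1, f q.2) : ℝ × ℝ)) p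
            ((-deriv g p.2 * p.1, g p.2) : ℝ × ℝ)
        = ((-deriv (fun θ : ℝ => f θ * deriv g θ - deriv f θ * g θ) p.2 * p.1,
            f p.2 * deriv g p.2 - deriv f p.2 * g p.2) : ℝ × ℝ)) := by
  have hdr : ∀ p : ℝ × ℝ, 0 < p.1 → DifferentiableAt ℝ ξr p := fun p hp =>
    (hξr.contDiffAt (isOpen_fst_pos.mem_nhds hp)).differentiableAt (by simp)
  have hdθ : ∀ p : ℝ × ℝ, 0 < p.1 → DifferentiableAt ℝ ξθ p := fun p hp =>
    (hξθ.contDiffAt (isOpen_fst_pos.mem_nhds hp)).differentiableAt (by simp)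
  refine ⟨⟨fun h => ?_, ?_⟩, fun f g hf hg p => ?_⟩
  · have hconst : ∀ p : ℝ × ℝ, 0 < p.1 → ξθ p = ξθ (1, p.2) := fun p hp =>
      eq_of_fderiv_fst_eq_zero_s16 hdθ (fun q hq => (h q hq).2.1) hp one_pos p.2
    refine ⟨fun θ => ξθ (1, θ), ?_, fun p hp => ⟨hconst p hp, ?_⟩⟩
    · exact hξθ.comp_contDiff (contDiff_const.prodMk contDiff_id) fun _ => one_pos (α := ℝ)
    · have hslice : (fun t => ξθ (p.1, t)) = fun θ => ξθ (1, θ) :=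
        funext fun t => hconst (p.1, t) hp
      rw [← hslice, (hasDerivAt_snd_slice (hdθ p hp)).deriv]
      linarith [(h p hp).2.2]
  · rintro ⟨f, hf, h⟩ p hp
    have hr : HasDerivAt (fun t => ξr (t, p.2)) (-deriv f p.2) p.1 := by
      refine ((hasDerivAt_id p.1).mul_const (-deriv f p.2)).congr_of_eventuallyEq ?_ |>.congr_deriv
        (one_mul _)
      filter_upwards [lt_mem_nhds hp] with t ht
      simp [(h (t, p.2) ht).2]
    have hθr : HasDerivAt (fun t => ξθ (t, p.2)) 0 p.1 := by
      refine (hasDerivAt_const p.1 (f p.2)).congr_of_eventuallyEq ?_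
      filter_upwards [lt_mem_nhds hp] with t ht
      exact (h (t, p.2) ht).1
    have hθθ : HasDerivAt (fun t => ξθ (p.1, t)) (deriv f p.2) p.2 := by
      rw [funext fun t => (h (p.1, t) hp).1]
      exact (hf.differentiable (by simp) p.2).hasDerivAt
    rw [(hasDerivAt_fst_slice (hdr p hp)).unique hr, (hasDerivAt_fst_slice (hdθ p hp)).unique hθr,
      (hasDerivAt_snd_slice (hdθ p hp)).unique hθθ, (h p hp).2]
    exact ⟨by ring, rfl, by ring⟩
  · have diff : ∀ {k : ℝ → ℝ}, ContDiff ℝ (⊤ : ℕ∞) k →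
        HasDerivAt k (deriv k p.2) p.2 ∧ HasDerivAt (deriv k) (deriv (deriv k) p.2) p.2 :=
      fun hk => ⟨(hk.differentiable (by simp) p.2).hasDerivAt,
        ((contDiff_infty_iff_deriv.1 hk).2.differentiable (by simp) p.2).hasDerivAt⟩
    obtain ⟨hf1, hf2⟩ := diff hf
    obtain ⟨hg1, hg2⟩ := diff hg
    have hw : HasDerivAt (fun θ : ℝ => f θ * deriv g θ - deriv f θ * g θ) _ p.2 :=
      (hf1.mul hg2).sub (hf2.mul hg1)
    rw [fderiv_killingField_apply hg, fderiv_killingField_apply hf, hw.deriv]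
    ext <;> simp only [Prod.fst_sub, Prod.snd_sub] <;> ring
end
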